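/- For every acceptance mode (σ,ρ) with σ ∈ {ran, inf} and ρ ∈ {⊓, ⊆, =}, the family of ω-languages (σ,ρ,nl)-accepted by phrase structure ω-grammars equals the family of ω-languages (σ,ρ)-accepted by single-tape Turing ω-machines: 𝓛_{σ,ρ,nl}(ω-PSG) = 𝓛_{σ,ρ}(ω-TM). -/

import Mathlib

namespace OmegaFormal

/-- σ component of an acceptance mode: `ran` (occurs at least once)
or `inf` (occurs infinitely often). -/
inductive AccSigma | ran | inf
deriving DecidableEq

/-- ρ component of an acceptance mode: `cap` (nonempty intersection, ⊓),
`sub` (⊆) or `eq` (=). -/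
inductive AccRho | cap | sub | eq
deriving DecidableEq

/-- derivation mode: leftmost (`l`) or normal (`nl`). -/
inductive DerivMode | l | nl
deriving DecidableEq

/-- `sigmaSet σ f` is ran(f) resp. inf(f). -/
def sigmaSet {Q : Type _} : AccSigma → (ℕ → Q) → Set Q
  | .ran, f => Set.range f
  | .inf, f => {q | ∀ n : ℕ, ∃ m : ℕ, n ≤ m ∧ f m = q}

/-- the binary relation denoted by ρ. -/
def rhoRel {Q : Type _} : AccRho → Set Q → Set Q → Prop
  | .cap, A, B => (A ∩ B).Nonempty
  | .sub, A, B => A ⊆ B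
  | .eq,  A, B => A = B

/-- f is (σ,ρ)-accepting w.r.t. the set 𝓕 of designated sets. -/
def IsAccepting {Q : Type _} (σ : AccSigma) (ρ : AccRho) (𝓕 : Set (Set Q)) (f : ℕ → Q) : Prop :=
  ∃ F ∈ 𝓕, rhoRel ρ (sigmaSet σ f) F

/-- the finite word `l` coincides with the prefix of the ω-word `u`. -/
def MatchesPrefix {T : Type _} (l : List T) (u : ℕ → T) : Prop :=
  ∀ (k : ℕ) (h : k < l.length), l.get ⟨k, h⟩ = u k

/-- the maximal terminal prefix of a sentential form. -/
def termPrefix {N T : Type _} : List (N ⊕ T) → List T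
  | [] => []
  | (Sum.inl _) :: _ => []
  | (Sum.inr a) :: l => a :: termPrefix l

/-- A phrase structure ω-grammar `G = (N, T, P, S, 𝓕)`:
`N` nonterminals, `T` terminals, `P` named productions `p : lhs p → rhs p`
with `lhs p ∈ N⁺`, `rhs p ∈ (N ∪ T)*`, start symbol, and
production repetition sets `acc ⊆ 2^P`. -/
structure OmegaPSG (T : Type) where
  N : Type
  [fintypeN : Fintype N]
  P : Type
  [fintypeP : Fintype P]
  lhs : P → List N
  lhs_ne : ∀ p : P, lhs p ≠ []
  rhs : P → List (N ⊕ T)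
  start : N
  acc : Set (Set P)

namespace OmegaPSG

variable {T : Type} (G : OmegaPSG T)

/-- one (normal) rewriting step using production p. -/
def Step (p : G.P) (x y : List (G.N ⊕ T)) : Prop :=
  ∃ u v : List (G.N ⊕ T),
    x = u ++ (G.lhs p).map Sum.inl ++ v ∧ y = u ++ G.rhs p ++ v

/-- one leftmost rewriting step: the rewritten occurrence starts at the
leftmost nonterminal, i.e. everything to its left is terminal. -/
def LStep (p : G.P) (x y : List (G.N ⊕ T)) : Prop :=
  ∃ u v : List (G.N ⊕ T), (∀ s ∈ u, ∃ a : T, s = Sum.inr a) ∧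
    x = u ++ (G.lhs p).map Sum.inl ++ v ∧ y = u ++ G.rhs p ++ v

def StepOf : DerivMode → G.P → List (G.N ⊕ T) → List (G.N ⊕ T) → Prop
  | .l => G.LStep
  | .nl => G.Step

/-- `L_{σ,ρ,π}(G)`: ω-words admitting an infinite π-derivation from S whose
growing terminal prefixes spell the word and whose production sequence is
(σ,ρ)-accepting w.r.t. `G.acc`. -/
def Lang (σ : AccSigma) (ρ : AccRho) (π : DerivMode) : Set (ℕ → T) :=
  {u | ∃ (s : ℕ → List (G.N ⊕ T)) (d : ℕ → G.P),
    s 0 = [Sum.inl G.start] ∧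
    (∀ i : ℕ, G.StepOf π (d i) (s i) (s (i + 1))) ∧
    (∀ n : ℕ, ∃ i : ℕ, n ≤ (termPrefix (s i)).length) ∧
    (∀ i : ℕ, MatchesPrefix (termPrefix (s i)) u) ∧
    IsAccepting σ ρ G.acc d}

/-- context-free: every left-hand side is a single nonterminal. -/
def IsCFG : Prop := ∀ p : G.P, (G.lhs p).length = 1

/-- context-sensitive (monotonic): `|β| ≥ |α|` for every production. -/
def IsCSG : Prop := ∀ p : G.P, (G.lhs p).length ≤ (G.rhs p).length

/-- right linear: productions of the form `A → uB` or `A → u`, `u ∈ T*`. -/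
def IsRLG : Prop :=
  ∀ p : G.P, (G.lhs p).length = 1 ∧
    ∃ (w : List T) (B : Option G.N),
      G.rhs p = w.map Sum.inr ++ B.toList.map Sum.inl

/-- `G` is a grammar with `$`-boundary (PSG version): with `$` = `dollar`,
`S` = `S'`, every production has one of the forms
(1) α → β, α,β ∈ N⁺ (N = nonterminals other than `$`, `S`),
(2) S → $α, α ∈ N⁺, (3) $A → a$, (4) A → ε. -/
def HasDollarBoundary (dollar S' : G.N) : Prop :=
  dollar ≠ S' ∧ G.start = S' ∧
  ∀ p : G.P,
    ((dollar ∉ G.lhs p ∧ S' ∉ G.lhs p) ∧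
      ∃ β : List G.N, β ≠ [] ∧ dollar ∉ β ∧ S' ∉ β ∧ G.rhs p = β.map Sum.inl) ∨
    (G.lhs p = [S'] ∧ ∃ α : List G.N, α ≠ [] ∧ dollar ∉ α ∧ S' ∉ α ∧
      G.rhs p = Sum.inl dollar :: α.map Sum.inl) ∨
    (∃ A : G.N, A ≠ dollar ∧ A ≠ S' ∧ G.lhs p = [dollar, A] ∧
      ∃ a : T, G.rhs p = [Sum.inr a, Sum.inl dollar]) ∨
    (∃ A : G.N, A ≠ dollar ∧ A ≠ S' ∧ G.lhs p = [A] ∧ G.rhs p = [])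

/-- `G` is a grammar with `$`-boundary (CSG version): forms (1)-(3) only,
with `|α| ≤ |β|` in form (1). -/
def HasDollarBoundaryCSG (dollar S' : G.N) : Prop :=
  dollar ≠ S' ∧ G.start = S' ∧
  ∀ p : G.P,
    ((dollar ∉ G.lhs p ∧ S' ∉ G.lhs p) ∧
      ∃ β : List G.N, β ≠ [] ∧ dollar ∉ β ∧ S' ∉ β ∧ (G.lhs p).length ≤ β.length ∧
        G.rhs p = β.map Sum.inl) ∨
    (G.lhs p = [S'] ∧ ∃ α : List G.N, α ≠ [] ∧ dollar ∉ α ∧ S' ∉ α ∧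
      G.rhs p = Sum.inl dollar :: α.map Sum.inl) ∨
    (∃ A : G.N, A ≠ dollar ∧ A ≠ S' ∧ G.lhs p = [dollar, A] ∧
      ∃ a : T, G.rhs p = [Sum.inr a, Sum.inl dollar])

end OmegaPSG

/-- `𝓛_{σ,ρ,π}(X)` for the family `X` of ω-grammars over `T` satisfying `C`. -/
def GLang (T : Type) (C : OmegaPSG T → Prop) (σ : AccSigma) (ρ : AccRho) (π : DerivMode) :
    Set (Set (ℕ → T)) :=
  {L | ∃ G : OmegaPSG T, C G ∧ L = G.Lang σ ρ π}

/-- number of non-ε labels among `b 0, …, b (i-1)`. -/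
def someCount {A : Type _} (b : ℕ → Option A) (i : ℕ) : ℕ :=
  ((Finset.range i).filter fun j => (b j).isSome = true).card

/-- the (ε-allowing) label sequence `b` concatenates to the ω-word `u`. -/
def Spells {A : Type _} (b : ℕ → Option A) (u : ℕ → A) : Prop :=
  (∀ n : ℕ, ∃ i : ℕ, n ≤ someCount b i) ∧
  ∀ i : ℕ, ∀ a : A, b i = some a → a = u (someCount b i)

/-- A finite state ω-automaton `(Q, Σ, δ, q₀, 𝓕)`. -/
structure OmegaFSA (Sig : Type) where
  Q : Type
  [fintypeQ : Fintype Q]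
  init : Q
  trans : Q → Option Sig → Q → Prop
  acc : Set (Set Q)

/-- `L_{σ,ρ}(A)` for a finite state ω-automaton. -/
def OmegaFSA.Lang {Sig : Type} (A : OmegaFSA Sig) (σ : AccSigma) (ρ : AccRho) :
    Set (ℕ → Sig) :=
  {u | ∃ (r : ℕ → A.Q) (b : ℕ → Option Sig),
    r 0 = A.init ∧ (∀ i : ℕ, A.trans (r i) (b i) (r (i + 1))) ∧
    Spells b u ∧ IsAccepting σ ρ A.acc r}

/-- `𝓛_{σ,ρ}(ω-FSA)`. -/
def FSALang (Sig : Type) (σ : AccSigma) (ρ : AccRho) : Set (Set (ℕ → Sig)) :=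
  {L | ∃ A : OmegaFSA Sig, L = A.Lang σ ρ}

/-- A pushdown ω-automaton `(Q, Σ, Γ, δ, q₀, Z₀, 𝓕)`. -/
structure OmegaPDA (Sig : Type) where
  Q : Type
  [fintypeQ : Fintype Q]
  Γ : Type
  [fintypeΓ : Fintype Γ]
  init : Q
  Z0 : Γ
  trans : Q → Option Sig → Γ → Q → List Γ → Prop
  acc : Set (Set Q)

/-- `L_{σ,ρ}(D)` for a pushdown ω-automaton. -/
def OmegaPDA.Lang {Sig : Type} (D : OmegaPDA Sig) (σ : AccSigma) (ρ : AccRho) :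
    Set (ℕ → Sig) :=
  {u | ∃ (q : ℕ → D.Q) (st : ℕ → List D.Γ) (b : ℕ → Option Sig),
    q 0 = D.init ∧ st 0 = [D.Z0] ∧
    (∀ i : ℕ, ∃ (Z : D.Γ) (γ rest : List D.Γ),
      st i = Z :: rest ∧ D.trans (q i) (b i) Z (q (i + 1)) γ ∧ st (i + 1) = γ ++ rest) ∧
    Spells b u ∧ IsAccepting σ ρ D.acc q}

/-- `𝓛_{σ,ρ}(ω-PDA)`. -/
def PDALang (Sig : Type) (σ : AccSigma) (ρ : AccRho) : Set (Set (ℕ → Sig)) :=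
  {L | ∃ D : OmegaPDA Sig, L = D.Lang σ ρ}

/-- tape head moves. -/
inductive Move | L | R | S
deriving DecidableEq

def moveHead : Move → ℕ → ℕ
  | .L, n => n - 1
  | .R, n => n + 1
  | .S, n => n

/-- A single-tape Turing ω-machine `(Q, Σ, Γ, δ, q₀, 𝓕)` (Σ ⊆ Γ via `embed`). -/
structure OmegaTM (Sig : Type) where
  Q : Type
  [fintypeQ : Fintype Q]
  Γ : Type
  [fintypeΓ : Fintype Γ]
  embed : Sig → Γ
  embed_inj : Function.Injective embed
  init : Q
  trans : Q → Γ → Q → Γ → Move → Prop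
  acc : Set (Set Q)

/-- `L_{σ,ρ}(M)`: ω-words admitting a complete non-oscillating run whose state
sequence is (σ,ρ)-accepting. -/
def OmegaTM.Lang {Sig : Type} (M : OmegaTM Sig) (σ : AccSigma) (ρ : AccRho) :
    Set (ℕ → Sig) :=
  {u | ∃ (q : ℕ → M.Q) (tape : ℕ → ℕ → M.Γ) (pos : ℕ → ℕ),
    q 0 = M.init ∧ (∀ n : ℕ, tape 0 n = M.embed (u n)) ∧ pos 0 = 0 ∧
    (∀ i : ℕ, ∃ (g : M.Γ) (m : Move),
      M.trans (q i) (tape i (pos i)) (q (i + 1)) g m ∧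
      tape (i + 1) = Function.update (tape i) (pos i) g ∧
      pos (i + 1) = moveHead m (pos i)) ∧
    (∀ n : ℕ, ∃ i : ℕ, n ≤ pos i) ∧
    (∀ n : ℕ, ∃ i0 : ℕ, ∀ i : ℕ, i0 ≤ i → pos i ≠ n) ∧
    IsAccepting σ ρ M.acc q}

/-- `𝓛_{σ,ρ}(ω-TM)`. -/
def TMLang (Sig : Type) (σ : AccSigma) (ρ : AccRho) : Set (Set (ℕ → Sig)) :=
  {L | ∃ M : OmegaTM Sig, L = M.Lang σ ρ}

/-- An m-tape Turing ω-machine. -/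
structure OmegaMTM (m : ℕ) (Sig : Type) where
  Q : Type
  [fintypeQ : Fintype Q]
  Γ : Type
  [fintypeΓ : Fintype Γ]
  embed : Sig → Γ
  embed_inj : Function.Injective embed
  blank : Γ
  init : Q
  trans : Q → (Fin m → Γ) → Q → (Fin m → Γ) → (Fin m → Move) → Prop
  acc : Set (Set Q)

/-- `L_{σ,ρ}(M)` for an m-tape Turing ω-machine (`hm : 0 < m`; the input is on
the first tape, the other tapes are initially blank; the run must be complete
and non-oscillating on the first tape). -/
def OmegaMTM.Lang {m : ℕ} {Sig : Type} (M : OmegaMTM m Sig) (hm : 0 < m)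
    (σ : AccSigma) (ρ : AccRho) : Set (ℕ → Sig) :=
  {u | ∃ (q : ℕ → M.Q) (tape : ℕ → Fin m → ℕ → M.Γ) (pos : ℕ → Fin m → ℕ),
    q 0 = M.init ∧
    (∀ n : ℕ, tape 0 ⟨0, hm⟩ n = M.embed (u n)) ∧
    (∀ j : Fin m, j ≠ ⟨0, hm⟩ → ∀ n : ℕ, tape 0 j n = M.blank) ∧
    (∀ j : Fin m, pos 0 j = 0) ∧
    (∀ i : ℕ, ∃ (g : Fin m → M.Γ) (mv : Fin m → Move),
      M.trans (q i) (fun j => tape i j (pos i j)) (q (i + 1)) g mv ∧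
      (∀ j : Fin m, tape (i + 1) j = Function.update (tape i j) (pos i j) (g j)) ∧
      (∀ j : Fin m, pos (i + 1) j = moveHead (mv j) (pos i j))) ∧
    (∀ n : ℕ, ∃ i : ℕ, n ≤ pos i ⟨0, hm⟩) ∧
    (∀ n : ℕ, ∃ i0 : ℕ, ∀ i : ℕ, i0 ≤ i → pos i ⟨0, hm⟩ ≠ n) ∧
    IsAccepting σ ρ M.acc q}

/-- `𝓛_{σ,ρ}(m-ω-TM)`. -/
def MTMLang (Sig : Type) (m : ℕ) (hm : 0 < m) (σ : AccSigma) (ρ : AccRho) :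
    Set (Set (ℕ → Sig)) :=
  {L | ∃ M : OmegaMTM m Sig, L = M.Lang hm σ ρ}

/-- the ω-language `{aⁿbⁿ | n ≥ 1}^ω` over the alphabet `Bool`
(`false` = a, `true` = b). -/
def abLang : Set (ℕ → Bool) :=
  {u | ∃ n : ℕ → ℕ, (∀ i : ℕ, 1 ≤ n i) ∧
    ∀ i k : ℕ, k < 2 * n i →
      u ((∑ j ∈ Finset.range i, 2 * n j) + k) = decide (n i ≤ k)}

end OmegaFormal

namespace OmegaFormal

section Acceptance

variable {Q P : Type*}

/-- Image of a set under a partial map. -/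
def partialImage (h : Q → Option P) (A : Set Q) : Set P := {b | ∃ q ∈ A, h q = some b}

/-- Pull designated sets back along a partial map, compatibly with `ρ`. -/
def pullAcc (ρ : AccRho) (h : Q → Option P) (𝓕 : Set (Set P)) : Set (Set Q) :=
  match ρ with
  | .cap => {A | ∃ F ∈ 𝓕, A = {q | ∃ b ∈ F, h q = some b}}
  | .sub => {A | ∃ F ∈ 𝓕, A = {q | ∀ b, h q = some b → b ∈ F}}
  | .eq => {A | partialImage h A ∈ 𝓕}

theorem exists_pullAcc_iff (ρ : AccRho) (h : Q → Option P) (𝓕 : Set (Set P)) (A : Set Q) :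
    (∃ A' ∈ pullAcc ρ h 𝓕, rhoRel ρ A A') ↔ ∃ F ∈ 𝓕, rhoRel ρ (partialImage h A) F := by
  cases ρ
  · constructor
    · rintro ⟨_, ⟨F, hF, rfl⟩, q, hq, b, hb, hqb⟩
      exact ⟨F, hF, b, ⟨q, hq, hqb⟩, hb⟩
    · rintro ⟨F, hF, b, ⟨q, hq, hqb⟩, hb⟩
      exact ⟨_, ⟨F, hF, rfl⟩, q, hq, b, hb, hqb⟩
  · constructor
    · rintro ⟨_, ⟨F, hF, rfl⟩, hA⟩
      refine ⟨F, hF, ?_⟩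
      rintro b ⟨q, hq, hqb⟩
      exact hA hq b hqb
    · rintro ⟨F, hF, hA⟩
      exact ⟨_, ⟨F, hF, rfl⟩, fun q hq b hqb => hA ⟨q, hq, hqb⟩⟩
  · constructor
    · rintro ⟨A', hA', rfl⟩
      exact ⟨_, hA', rfl⟩
    · rintro ⟨F, hF, hA⟩
      refine ⟨A, ?_, rfl⟩
      change partialImage h A = F at hA
      change partialImage h A ∈ 𝓕
      rwa [hA]

/-- `lev` counts the labelled positions of `ℓ`, and the labels of `ℓ`, in order, are `d`. -/
structure Stutter (ℓ : ℕ → Option P) (d : ℕ → P) (lev : ℕ → ℕ) : Prop where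
  zero : lev 0 = 0
  unbounded : ∀ n, ∃ i, n ≤ lev i
  step : ∀ i, (ℓ i = none ∧ lev (i + 1) = lev i) ∨
    (ℓ i = some (d (lev i)) ∧ lev (i + 1) = lev i + 1)

namespace Stutter

variable {ℓ : ℕ → Option P} {d : ℕ → P} {lev : ℕ → ℕ}

theorem mono (H : Stutter ℓ d lev) : Monotone lev :=
  monotone_nat_of_le_succ fun i => by rcases H.step i with h | h <;> omega

theorem exists_jump (H : Stutter ℓ d lev) (k : ℕ) :
    ∃ i, lev i = k ∧ lev (i + 1) = k + 1 ∧ ℓ i = some (d k) := by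
  classical
  have hex := H.unbounded (k + 1)
  have hspec := Nat.find_spec hex
  rcases hn : Nat.find hex with _ | i
  · rw [hn, H.zero] at hspec
    omega
  · have hlt : ¬ k + 1 ≤ lev i := Nat.find_min hex (by omega)
    rw [hn] at hspec
    rcases H.step i with ⟨_, h⟩ | ⟨h', h⟩
    · omega
    · have hk : lev i = k := by omega
      exact ⟨i, hk, by omega, hk ▸ h'⟩

theorem partialImage_sigmaSet [Finite Q] {h : Q → Option P} {f : ℕ → Q}
    (H : Stutter (fun i => h (f i)) d lev) (σ : AccSigma) :
    partialImage h (sigmaSet σ f) = sigmaSet σ d := by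
  have hsome : ∀ i b, h (f i) = some b → d (lev i) = b := by
    intro i b hb
    rcases H.step i with ⟨h', _⟩ | ⟨h', _⟩
    · simp [hb] at h'
    · simpa [hb, eq_comm] using h'
  cases σ
  · ext b
    constructor
    · rintro ⟨_, ⟨i, rfl⟩, hb⟩
      exact ⟨lev i, hsome i b hb⟩
    · rintro ⟨k, rfl⟩
      obtain ⟨i, _, _, hi⟩ := H.exists_jump k
      exact ⟨f i, ⟨i, rfl⟩, hi⟩
  · ext b
    constructor
    · rintro ⟨q, hq, hb⟩ n
      obtain ⟨i, hi⟩ := H.unbounded n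
      obtain ⟨m, hm, rfl⟩ := hq i
      exact ⟨lev m, hi.trans (H.mono hm), hsome m b hb⟩
    · intro hb
      by_contra hcon
      have hbd : ∀ q, h q = some b → ∃ n, ∀ m, n ≤ m → f m ≠ q := by
        intro q hq
        by_contra hq'
        push Not at hq'
        exact hcon ⟨q, hq', hq⟩
      choose! N hN using hbd
      obtain ⟨B, hB⟩ := (Set.finite_range N).bddAbove
      obtain ⟨k, hk, rfl⟩ := hb (lev B + 1)
      obtain ⟨i, hik, _, hi⟩ := H.exists_jump k
      have hBi : B ≤ i := by
        by_contra hlt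
        have := H.mono (not_le.mp hlt).le
        omega
      exact hN (f i) hi i ((hB ⟨f i, rfl⟩).trans hBi) rfl

theorem isAccepting_iff [Finite Q] {h : Q → Option P} {f : ℕ → Q}
    (H : Stutter (fun i => h (f i)) d lev) (σ : AccSigma) (ρ : AccRho) (𝓕 : Set (Set P)) :
    IsAccepting σ ρ (pullAcc ρ h 𝓕) f ↔ IsAccepting σ ρ 𝓕 d := by
  unfold IsAccepting
  rw [exists_pullAcc_iff, H.partialImage_sigmaSet]

end Stutter

end Acceptance

section Sequences

variable {α β : Type*}

theorem exists_seq_of_invariant (I : ℕ → α → Prop) (R : ℕ → α → α → Prop) (a : α) (h0 : I 0 a)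
    (hs : ∀ i x, I i x → ∃ y, I (i + 1) y ∧ R i x y) :
    ∃ A : ℕ → α, A 0 = a ∧ ∀ i, I i (A i) ∧ R i (A i) (A (i + 1)) := by
  choose! g hg using hs
  have hI : ∀ i, I i (Nat.rec a (fun i x => g i x) i) := by
    intro i
    induction i with
    | zero => exact h0
    | succ i ih => exact (hg i _ ih).1
  exact ⟨fun i => Nat.rec a (fun i x => g i x) i, rfl, fun i => ⟨hI i, (hg i _ (hI i)).2⟩⟩

/-- Remove the silent steps from a sequence with infinitely many labelled steps. -/
theorem exists_unstutter (A : ℕ → α) (ℓ : ℕ → Option β) (R : β → α → α → Prop)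
    (h : ∀ i, (ℓ i = none ∧ A (i + 1) = A i) ∨ ∃ b, ℓ i = some b ∧ R b (A i) (A (i + 1)))
    (hinf : ∀ n, ∃ i, n ≤ i ∧ ℓ i ≠ none) :
    ∃ (c : ℕ → α) (d : ℕ → β) (lev : ℕ → ℕ), Stutter ℓ d lev ∧
      (∀ i, A i = c (lev i)) ∧ ∀ k, R (d k) (c k) (c (k + 1)) := by
  classical
  set p : ℕ → Prop := fun i => ℓ i ≠ none with hp
  have hpinf : {i | p i}.Infinite := by
    rw [Set.infinite_iff_exists_gt]
    intro n
    obtain ⟨i, hi, hi'⟩ := hinf (n + 1)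
    exact ⟨i, hi', by omega⟩
  have hpn : ∀ k, p (Nat.nth p k) := fun k => Nat.nth_mem_of_infinite hpinf k
  have hd : ∀ k, ∃ b, ℓ (Nat.nth p k) = some b := fun k => Option.ne_none_iff_exists'.mp (hpn k)
  choose d hd using hd
  have H : Stutter ℓ d (Nat.count p) := by
    refine ⟨Nat.count_zero p, fun n => ⟨Nat.nth p n, (Nat.count_nth_of_infinite hpinf n).ge⟩, ?_⟩
    intro i
    by_cases hi : p i
    · right
      refine ⟨?_, by rw [Nat.count_succ, if_pos hi]⟩
      rw [← hd, Nat.nth_count hi]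
    · left
      exact ⟨not_not.mp hi, by rw [Nat.count_succ, if_neg hi, add_zero]⟩
  have hconst : ∀ i n, Nat.count p (i + n) = Nat.count p i → A (i + n) = A i := by
    intro i n
    induction n with
    | zero => intro _; rfl
    | succ n ih =>
      intro hn
      have h1 : Nat.count p i ≤ Nat.count p (i + n) := H.mono (by omega)
      have h2 : Nat.count p (i + n) ≤ Nat.count p (i + (n + 1)) := H.mono (by omega)
      rw [← ih (by omega)]
      rcases h (i + n) with ⟨_, h'⟩ | ⟨b, hb, _⟩
      · exact h'
      · rcases H.step (i + n) with ⟨h3, _⟩ | ⟨_, h3⟩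
        · simp [hb] at h3
        · rw [← add_assoc] at hn
          omega
  have heq : ∀ i j, Nat.count p i = Nat.count p j → A i = A j := by
    intro i j hij
    rcases le_total i j with hle | hle
    · obtain ⟨n, rfl⟩ := Nat.exists_eq_add_of_le hle
      exact (hconst i n hij.symm).symm
    · obtain ⟨n, rfl⟩ := Nat.exists_eq_add_of_le hle
      exact hconst j n hij
  have hAc : ∀ i, A i = A (Nat.nth p (Nat.count p i)) := fun i =>
    heq _ _ (Nat.count_nth_of_infinite hpinf _).symm
  refine ⟨fun k => A (Nat.nth p k), d, Nat.count p, H, hAc, fun k => ?_⟩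
  rcases h (Nat.nth p k) with ⟨h', _⟩ | ⟨b, hb, hR⟩
  · simp [hd] at h'
  · rw [hd, Option.some_inj] at hb
    subst hb
    rw [hAc (Nat.nth p k + 1), Nat.count_succ, if_pos (hpn k),
      Nat.count_nth_of_infinite hpinf] at hR
    exact hR

/-- `b` is reachable from `a` in exactly `n` steps of `R`. -/
def NSteps (R : α → α → Prop) : ℕ → α → α → Prop
  | 0, a, b => a = b
  | n + 1, a, b => ∃ c, R a c ∧ NSteps R n c b

theorem exists_nSteps {R : α → α → Prop} {a b : α} (h : Relation.ReflTransGen R a b) :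
    ∃ n, NSteps R n a b := by
  induction h using Relation.ReflTransGen.head_induction_on with
  | refl => exact ⟨0, rfl⟩
  | head h _ ih =>
    obtain ⟨n, hn⟩ := ih
    exact ⟨n + 1, _, h, hn⟩

/-- Concatenate infinitely many finite paths, each ending with a labelled step. -/
theorem exists_concat (R L : ℕ → α → α → Prop) (C C' : ℕ → α)
    (h1 : ∀ k, Relation.ReflTransGen (R k) (C k) (C' k)) (h2 : ∀ k, L k (C' k) (C (k + 1))) :
    ∃ (f : ℕ → α) (lev : ℕ → ℕ), f 0 = C 0 ∧ lev 0 = 0 ∧ (∀ n, ∃ i, n ≤ lev i) ∧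
      ∀ i, (R (lev i) (f i) (f (i + 1)) ∧ lev (i + 1) = lev i) ∨
        (L (lev i) (f i) (f (i + 1)) ∧ lev (i + 1) = lev i + 1) := by
  choose N hN using fun k => exists_nSteps (h1 k)
  obtain ⟨A, hA0, hA⟩ := exists_seq_of_invariant
    (fun _ (x : ℕ × ℕ × α) => NSteps (R x.1) x.2.1 x.2.2 (C' x.1))
    (fun _ x y => (R x.1 x.2.2 y.2.2 ∧ y.1 = x.1 ∧ y.2.1 + 1 = x.2.1) ∨
      (L x.1 x.2.2 y.2.2 ∧ y.1 = x.1 + 1 ∧ x.2.1 = 0)) (0, N 0, C 0) (hN 0) (by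
    rintro - ⟨k, n, c⟩ hx
    rcases n with _ | n
    · have hc : c = C' k := hx
      subst hc
      exact ⟨(k + 1, N (k + 1), C (k + 1)), hN (k + 1), Or.inr ⟨h2 k, rfl, rfl⟩⟩
    · obtain ⟨c', hc, hn⟩ := hx
      exact ⟨(k, n, c'), hn, Or.inl ⟨hc, rfl, rfl⟩⟩)
  refine ⟨fun i => (A i).2.2, fun i => (A i).1, by simp [hA0], by simp [hA0], ?_, ?_⟩
  · have hnext : ∀ n i, (A i).2.1 = n → ∃ j, (A j).1 = (A i).1 + 1 := by
      intro n
      induction n with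
      | zero =>
        intro i hi
        rcases (hA i).2 with ⟨_, _, h⟩ | ⟨_, h, _⟩
        · omega
        · exact ⟨i + 1, h⟩
      | succ n ih =>
        intro i hi
        rcases (hA i).2 with ⟨_, h, h'⟩ | ⟨_, _, h⟩
        · obtain ⟨j, hj⟩ := ih (i + 1) (by omega)
          exact ⟨j, by rw [hj, h]⟩
        · omega
    intro n
    induction n with
    | zero => exact ⟨0, Nat.zero_le _⟩
    | succ n ih =>
      obtain ⟨i, hi⟩ := ih
      obtain ⟨j, hj⟩ := hnext _ i rfl
      have hi' : n ≤ (A i).1 := hi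
      exact ⟨j, show n + 1 ≤ (A j).1 by omega⟩
  · intro i
    rcases (hA i).2 with ⟨h, h', _⟩ | ⟨h, h', _⟩
    · exact Or.inl ⟨h, h'⟩
    · exact Or.inr ⟨h, h'⟩

end Sequences

section TerminalPrefix

variable {N T : Type*}

theorem getElem?_of_termPrefix {x : List (N ⊕ T)} {j : ℕ} {t : T}
    (h : (termPrefix x)[j]? = some t) : x[j]? = some (Sum.inr t) := by
  induction x generalizing j with
  | nil => simp [termPrefix] at h
  | cons a x ih =>
    rcases a with a | a
    · simp [termPrefix] at h
    · rcases j with _ | j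
      · simpa [termPrefix] using h
      · simpa [termPrefix] using ih (by simpa [termPrefix] using h)

theorem le_length_termPrefix {x : List (N ⊕ T)} {n : ℕ}
    (h : ∀ j < n, ∃ t, x[j]? = some (Sum.inr t)) : n ≤ (termPrefix x).length := by
  induction x generalizing n with
  | nil =>
    rcases n with _ | n
    · simp
    · simpa using h 0 (by omega)
  | cons a x ih =>
    rcases n with _ | n
    · simp
    · obtain ⟨t, ht⟩ := h 0 (by omega)
      obtain rfl : a = Sum.inr t := by simpa using ht
      have := ih (n := n) fun j hj => by simpa using h (j + 1) (by omega)
      simpa [termPrefix] using this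

theorem termPrefix_length_le {x : List (N ⊕ T)} {j : ℕ} {A : N}
    (h : x[j]? = some (Sum.inl A)) : (termPrefix x).length ≤ j := by
  by_contra hlt
  rw [not_le] at hlt
  have := getElem?_of_termPrefix (List.getElem?_eq_getElem hlt)
  simp [h] at this

theorem termPrefix_isPrefix_append (x y : List (N ⊕ T)) :
    termPrefix x <+: termPrefix (x ++ y) := by
  induction x with
  | nil => simp [termPrefix]
  | cons a x ih =>
    rcases a with a | a
    · simp [termPrefix]
    · simpa [termPrefix] using ih

theorem termPrefix_append_inl (x : List (N ⊕ T)) (A : N) (y : List (N ⊕ T)) :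
    termPrefix (x ++ Sum.inl A :: y) = termPrefix x := by
  induction x with
  | nil => simp [termPrefix]
  | cons a x ih =>
    rcases a with a | a
    · simp [termPrefix]
    · simpa [termPrefix] using ih

theorem matchesPrefix_iff {l : List T} {u : ℕ → T} :
    MatchesPrefix l u ↔ ∀ j t, l[j]? = some t → t = u j := by
  constructor
  · intro h j t hj
    obtain ⟨hlt, rfl⟩ := List.getElem?_eq_some_iff.mp hj
    simpa using h j hlt
  · intro h k hk
    exact h k _ (by simp)

end TerminalPrefix

theorem OmegaPSG.Step.termPrefix_grows {T : Type} {G : OmegaPSG T} {p : G.P}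
    {x y : List (G.N ⊕ T)} (h : G.Step p x y) : termPrefix x <+: termPrefix y := by
  obtain ⟨a, v, rfl, rfl⟩ := h
  rcases hl : G.lhs p with _ | ⟨A, l⟩
  · exact absurd hl (G.lhs_ne p)
  · simp only [List.map_cons, List.append_assoc, List.cons_append, termPrefix_append_inl]
    exact termPrefix_isPrefix_append _ _

theorem OmegaPSG.termPrefix_grows_of_le {T : Type} {G : OmegaPSG T} {s : ℕ → List (G.N ⊕ T)}
    {d : ℕ → G.P} (h : ∀ i, G.Step (d i) (s i) (s (i + 1))) {i j : ℕ} (hij : i ≤ j) :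
    termPrefix (s i) <+: termPrefix (s j) := by
  induction j, hij using Nat.le_induction with
  | base => exact List.prefix_rfl
  | succ j _ ih => exact ih.trans (h j).termPrefix_grows

theorem moveHead_le (m : Move) (p : ℕ) : moveHead m p ≤ p + 1 := by
  cases m <;> simp [moveHead]; omega

/-- Configurations of a Turing machine. -/
structure Cfg (Q Γ : Type*) where
  q : Q
  tape : ℕ → Γ
  pos : ℕ

/-- One step of a Turing machine with transition relation `δ`. -/
def TMStep {Q Γ : Type*} (δ : Q → Γ → Q → Γ → Move → Prop) (c c' : Cfg Q Γ) : Prop :=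
  ∃ g m, δ c.q (c.tape c.pos) c'.q g m ∧ c'.tape = Function.update c.tape c.pos g ∧
    c'.pos = moveHead m c.pos

theorem OmegaTM.mem_Lang_iff {T : Type} (M : OmegaTM T) (σ : AccSigma) (ρ : AccRho) (u : ℕ → T) :
    u ∈ M.Lang σ ρ ↔ ∃ c : ℕ → Cfg M.Q M.Γ, c 0 = ⟨M.init, fun n => M.embed (u n), 0⟩ ∧
      (∀ i, TMStep M.trans (c i) (c (i + 1))) ∧ (∀ n, ∃ i, n ≤ (c i).pos) ∧
      (∀ n, ∃ i0, ∀ i, i0 ≤ i → (c i).pos ≠ n) ∧ IsAccepting σ ρ M.acc fun i => (c i).q := by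
  constructor
  · rintro ⟨q, tape, pos, hq, ht, hp, h⟩
    exact ⟨fun i => ⟨q i, tape i, pos i⟩, by simp only [hq, hp, funext ht], h⟩
  · rintro ⟨c, h0, h⟩
    exact ⟨fun i => (c i).q, fun i => (c i).tape, fun i => (c i).pos, by simp [h0], by simp [h0],
      by simp [h0], h⟩

theorem getElem?_append_mid {α : Type*} (a l v : List α) {j : ℕ} (h : j < l.length) :
    (a ++ l ++ v)[a.length + j]? = l[j]? := by
  rw [List.append_assoc, List.getElem?_append_right (by omega), List.getElem?_append_left (by omega)]
  congr 1
  omega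

/-- The list of the `a` values of `f` starting at `k`. -/
def window {α : Type*} (f : ℕ → α) (k a : ℕ) : List α := (List.range a).map fun i => f (k + i)

section window

variable {α : Type*} {f g : ℕ → α} {k a b : ℕ}

@[simp]
theorem length_window : (window f k a).length = a := by simp [window]

@[simp]
theorem window_zero : window f k 0 = [] := rfl

theorem window_add : window f k (a + b) = window f k a ++ window f (k + a) b := by
  simp [window, List.range_add, Nat.add_assoc]

theorem window_one : window f k 1 = [f k] := rfl

theorem window_succ : window f k (a + 1) = window f k a ++ [f (k + a)] := window_add

theorem window_succ' : window f k (a + 1) = f k :: window f (k + 1) a := by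
  rw [Nat.add_comm a, window_add, window_one]
  rfl

theorem window_congr (h : ∀ j, k ≤ j → j < k + a → f j = g j) : window f k a = window g k a := by
  apply List.map_congr_left
  intro j hj
  exact h _ (by omega) (by have := List.mem_range.mp hj; omega)

theorem getElem?_window {j : ℕ} (h : j < a) : (window f k a)[j]? = some (f (k + j)) := by
  simp [window, h]

theorem window_getElem?_mid (x l v : List α) :
    window (fun n => (x ++ l ++ v)[n]?) x.length l.length = l.map some := by
  apply List.ext_getElem
  · simp
  · intro i h1 h2
    simp only [length_window] at h1
    simp only [window, List.getElem_map, List.getElem_range]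
    rw [getElem?_append_mid _ _ _ h1, List.getElem?_eq_getElem h1]

end window

/-! ### From Turing machines to grammars -/

namespace TMGrammar

/-- Nonterminals of the grammar simulating a Turing machine: a cell remembers its input letter,
its current content, and whether it is the first one. -/
inductive NT (Q Γ T : Type)
  | start
  | tail
  | cell (t : T) (g : Γ) (b : Bool)
  | head (q : Q) (t : T) (g : Γ) (b : Bool)

instance (Q Γ T : Type) [Finite Q] [Finite Γ] [Finite T] : Finite (NT Q Γ T) := by
  let f : Bool ⊕ (T × Γ × Bool) ⊕ (Q × T × Γ × Bool) → NT Q Γ T := fun x =>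
    match x with
    | .inl true => .start
    | .inl false => .tail
    | .inr (.inl (t, g, b)) => .cell t g b
    | .inr (.inr (q, t, g, b)) => .head q t g b
  refine Finite.of_surjective f ?_
  rintro (_ | _ | ⟨t, g, b⟩ | ⟨q, t, g, b⟩)
  · exact ⟨.inl true, rfl⟩
  · exact ⟨.inl false, rfl⟩
  · exact ⟨.inr (.inl (t, g, b)), rfl⟩
  · exact ⟨.inr (.inr (q, t, g, b)), rfl⟩

/-- Candidate productions. -/
inductive Rule (Q Γ T : Type)
  | init (t : T)
  | ext (t : T)
  | out (t : T) (g : Γ) (b : Bool)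
  | stay (q : Q) (t : T) (g : Γ) (b : Bool) (q' : Q) (g' : Γ)
  | right (q : Q) (t : T) (g : Γ) (b : Bool) (q' : Q) (g' : Γ) (t₂ : T) (g₂ : Γ) (b₂ : Bool)
  | left (q : Q) (t : T) (g : Γ) (b : Bool) (q' : Q) (g' : Γ) (t₂ : T) (g₂ : Γ) (b₂ : Bool)

instance (Q Γ T : Type) [Finite Q] [Finite Γ] [Finite T] : Finite (Rule Q Γ T) := by
  let f : T ⊕ T ⊕ (T × Γ × Bool) ⊕ (Q × T × Γ × Bool × Q × Γ) ⊕
      (Bool × Q × T × Γ × Bool × Q × Γ × T × Γ × Bool) → Rule Q Γ T := fun x =>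
    match x with
    | .inl t => .init t
    | .inr (.inl t) => .ext t
    | .inr (.inr (.inl (t, g, b))) => .out t g b
    | .inr (.inr (.inr (.inl (q, t, g, b, q', g')))) => .stay q t g b q' g'
    | .inr (.inr (.inr (.inr (true, q, t, g, b, q', g', t₂, g₂, b₂)))) =>
      .right q t g b q' g' t₂ g₂ b₂
    | .inr (.inr (.inr (.inr (false, q, t, g, b, q', g', t₂, g₂, b₂)))) =>
      .left q t g b q' g' t₂ g₂ b₂
  refine Finite.of_surjective f ?_
  rintro (t | t | ⟨t, g, b⟩ | ⟨q, t, g, b, q', g'⟩ | ⟨q, t, g, b, q', g', t₂, g₂, b₂⟩ |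
    ⟨q, t, g, b, q', g', t₂, g₂, b₂⟩)
  · exact ⟨.inl t, rfl⟩
  · exact ⟨.inr (.inl t), rfl⟩
  · exact ⟨.inr (.inr (.inl (t, g, b))), rfl⟩
  · exact ⟨.inr (.inr (.inr (.inl (q, t, g, b, q', g')))), rfl⟩
  · exact ⟨.inr (.inr (.inr (.inr (true, q, t, g, b, q', g', t₂, g₂, b₂)))), rfl⟩
  · exact ⟨.inr (.inr (.inr (.inr (false, q, t, g, b, q', g', t₂, g₂, b₂)))), rfl⟩

variable {T : Type} (M : OmegaTM T)

/-- The rule is backed by a transition of the machine. -/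
def Rule.Valid : Rule M.Q M.Γ T → Prop
  | .init _ => True
  | .ext _ => True
  | .out _ _ _ => True
  | .stay q _ g b q' g' => M.trans q g q' g' .S ∨ b = true ∧ M.trans q g q' g' .L
  | .right q _ g _ q' g' _ _ _ => M.trans q g q' g' .R
  | .left q _ g _ q' g' _ _ _ => M.trans q g q' g' .L

/-- Left-hand sides. -/
def Rule.lhs {Q Γ : Type} : Rule Q Γ T → List (NT Q Γ T)
  | .init _ => [.start]
  | .ext _ => [.tail]
  | .out t g b => [.cell t g b]
  | .stay q t g b _ _ => [.head q t g b]
  | .right q t g b _ _ t₂ g₂ b₂ => [.head q t g b, .cell t₂ g₂ b₂]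
  | .left q t g b _ _ t₂ g₂ b₂ => [.cell t₂ g₂ b₂, .head q t g b]

/-- Right-hand sides. -/
def Rule.rhs : Rule M.Q M.Γ T → List (NT M.Q M.Γ T ⊕ T)
  | .init t => [.inl (.head M.init t (M.embed t) true), .inl .tail]
  | .ext t => [.inl (.cell t (M.embed t) false), .inl .tail]
  | .out t _ _ => [.inr t]
  | .stay _ t _ b q' g' => [.inl (.head q' t g' b)]
  | .right _ t _ b q' g' t₂ g₂ b₂ => [.inl (.cell t g' b), .inl (.head q' t₂ g₂ b₂)]
  | .left _ t _ b q' g' t₂ g₂ b₂ => [.inl (.head q' t₂ g₂ b₂), .inl (.cell t g' b)]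

/-- The state consumed by a rule simulating a machine step. -/
def Rule.state {Q Γ : Type} : Rule Q Γ T → Option Q
  | .init _ => none
  | .ext _ => none
  | .out _ _ _ => none
  | .stay q _ _ _ _ _ => some q
  | .right q _ _ _ _ _ _ _ _ => some q
  | .left q _ _ _ _ _ _ _ _ => some q

/-- The grammar simulating `M` in acceptance mode `(_, ρ)`. -/
noncomputable def grammar [Fintype T] (ρ : AccRho) : OmegaPSG T :=
  letI := M.fintypeQ
  letI := M.fintypeΓ
  { N := NT M.Q M.Γ T
    fintypeN := Fintype.ofFinite _
    P := {r : Rule M.Q M.Γ T // r.Valid M}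
    fintypeP := Fintype.ofFinite _
    lhs := fun r => r.1.lhs
    lhs_ne := by rintro ⟨_ | _, _⟩ <;> simp [Rule.lhs]
    rhs := fun r => r.1.rhs M
    start := .start
    acc := pullAcc ρ (fun r => r.1.state) M.acc }

/-- Rewriting with a rule. -/
def RStep (r : Rule M.Q M.Γ T) (x y : List (NT M.Q M.Γ T ⊕ T)) : Prop :=
  ∃ a v, x = a ++ r.lhs.map Sum.inl ++ v ∧ y = a ++ r.rhs M ++ v

/-- The input letter carried by a symbol. -/
def letter {Q Γ : Type} : NT Q Γ T ⊕ T → Option T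
  | .inl .start => none
  | .inl .tail => none
  | .inl (.cell t _ _) => some t
  | .inl (.head _ t _ _) => some t
  | .inr t => some t

@[simp]
theorem letter_start {Q Γ : Type} : letter (.inl .start : NT Q Γ T ⊕ T) = none := rfl

@[simp]
theorem letter_tail {Q Γ : Type} : letter (.inl .tail : NT Q Γ T ⊕ T) = none := rfl

@[simp]
theorem letter_cell {Q Γ : Type} (t : T) (g : Γ) (b : Bool) :
    letter (.inl (.cell t g b) : NT Q Γ T ⊕ T) = some t := rfl

@[simp]
theorem letter_head {Q Γ : Type} (q : Q) (t : T) (g : Γ) (b : Bool) :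
    letter (.inl (.head q t g b) : NT Q Γ T ⊕ T) = some t := rfl

@[simp]
theorem letter_inr {Q Γ : Type} (t : T) : letter (.inr t : NT Q Γ T ⊕ T) = some t := rfl

/-- Only the last symbol may carry no letter. -/
def Shape {Q Γ : Type} (x : List (NT Q Γ T ⊕ T)) : Prop :=
  ∀ s ∈ x.dropLast, letter s ≠ none

variable {M}

theorem Shape.getElem?_filterMap {Q Γ : Type} {x : List (NT Q Γ T ⊕ T)} (hx : Shape x) {j : ℕ}
    {s : NT Q Γ T ⊕ T} {t : T} (hj : x[j]? = some s) (ht : letter s = some t) :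
    (x.filterMap letter)[j]? = some t := by
  induction x generalizing j with
  | nil => simp at hj
  | cons y x ih =>
    rcases j with _ | j
    · obtain rfl : y = s := by simpa using hj
      simp [ht]
    · have hj' : x[j]? = some s := by simpa using hj
      have hne : x ≠ [] := by rintro rfl; simp at hj'
      obtain ⟨z, x, rfl⟩ := List.exists_cons_of_ne_nil hne
      have hy : letter y ≠ none := hx y (by simp)
      obtain ⟨t', ht'⟩ := Option.ne_none_iff_exists'.mp hy
      have := ih (fun s hs => hx s (by
        rw [List.dropLast_cons_cons]
        exact List.mem_cons_of_mem _ hs)) hj'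
      rw [List.filterMap_cons, ht']
      simpa using this

theorem RStep.shape {r : Rule M.Q M.Γ T} {x y : List (NT M.Q M.Γ T ⊕ T)} (h : RStep M r x y)
    (hx : Shape x) : Shape y ∧ x.filterMap letter <+: y.filterMap letter := by
  obtain ⟨a, v, rfl, rfl⟩ := h
  unfold Shape at *
  rcases List.eq_nil_or_concat v with rfl | ⟨v, z, rfl⟩
  · cases r <;>
      simp_all [Rule.lhs, Rule.rhs, List.filterMap_cons, or_imp]
  · rw [List.concat_eq_append, ← List.append_assoc, List.dropLast_concat] at hx
    rw [List.concat_eq_append, ← List.append_assoc, ← List.append_assoc, List.dropLast_concat]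
    cases r <;>
      simp_all [Rule.lhs, Rule.rhs, List.filterMap_cons, or_imp, forall_and]

/-- The form `x`, of `n` cells, encodes the configuration `c` on input `u`. -/
structure EncodesCells (M : OmegaTM T) (u : ℕ → T) (x : List (NT M.Q M.Γ T ⊕ T))
    (c : Cfg M.Q M.Γ) (n : ℕ) : Prop where
  length : x.length = n + 1
  tail : x[n]? = some (.inl .tail)
  pos_lt : c.pos < n
  head : x[c.pos]? = some (.inl (.head c.q (u c.pos) (c.tape c.pos) (decide (c.pos = 0))))
  cell : ∀ j < n, j ≠ c.pos → x[j]? = some (.inl (.cell (u j) (c.tape j) (decide (j = 0)))) ∨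
    x[j]? = some (.inr (u j))
  fresh : ∀ j, n ≤ j → c.tape j = M.embed (u j)

/-- The form `x` encodes the configuration `c` on input `u`. -/
def Encodes (M : OmegaTM T) (u : ℕ → T) (x : List (NT M.Q M.Γ T ⊕ T)) (c : Cfg M.Q M.Γ) : Prop :=
  (x = [.inl .start] ∧ c = ⟨M.init, fun n => M.embed (u n), 0⟩) ∨ ∃ n, EncodesCells M u x c n

namespace EncodesCells

variable {u : ℕ → T} {x : List (NT M.Q M.Γ T ⊕ T)} {c : Cfg M.Q M.Γ} {n k : ℕ}

theorem cases (h : EncodesCells M u x c n) {s : NT M.Q M.Γ T ⊕ T} (hk : x[k]? = some s) :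
    (k = n ∧ s = .inl .tail) ∨
    (k = c.pos ∧ s = .inl (.head c.q (u k) (c.tape k) (decide (k = 0)))) ∨
    (k < n ∧ k ≠ c.pos ∧ (s = .inl (.cell (u k) (c.tape k) (decide (k = 0))) ∨ s = .inr (u k))) := by
  obtain ⟨hlt, -⟩ := List.getElem?_eq_some_iff.mp hk
  rw [h.length] at hlt
  rcases Nat.lt_succ_iff_lt_or_eq.mp hlt with hlt | rfl
  · by_cases hp : k = c.pos
    · subst hp
      rw [h.head, Option.some_inj] at hk
      exact Or.inr (Or.inl ⟨rfl, hk.symm⟩)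
    · right; right
      refine ⟨hlt, hp, ?_⟩
      rcases h.cell k hlt hp with h' | h' <;> rw [h', Option.some_inj] at hk
      · exact Or.inl hk.symm
      · exact Or.inr hk.symm
  · rw [h.tail, Option.some_inj] at hk
    exact Or.inl ⟨rfl, hk.symm⟩

theorem eq_of_tail (h : EncodesCells M u x c n) (hk : x[k]? = some (.inl .tail)) : k = n := by
  rcases h.cases hk with ⟨h, _⟩ | ⟨_, h⟩ | ⟨_, _, h | h⟩
  · exact h
  all_goals simp at h

theorem false_of_start (h : EncodesCells M u x c n) (hk : x[k]? = some (.inl .start)) : False := by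
  rcases h.cases hk with ⟨_, h⟩ | ⟨_, h⟩ | ⟨_, _, h | h⟩ <;> simp at h

theorem of_cell (h : EncodesCells M u x c n) {t : T} {g : M.Γ} {b : Bool}
    (hk : x[k]? = some (.inl (.cell t g b))) :
    k < n ∧ k ≠ c.pos ∧ t = u k ∧ g = c.tape k ∧ b = decide (k = 0) := by
  rcases h.cases hk with ⟨_, h⟩ | ⟨_, h⟩ | ⟨h1, h2, h | h⟩
  · simp at h
  · simp at h
  · simp only [Sum.inl.injEq, NT.cell.injEq] at h
    exact ⟨h1, h2, h⟩
  · simp at h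

theorem of_head (h : EncodesCells M u x c n) {q : M.Q} {t : T} {g : M.Γ} {b : Bool}
    (hk : x[k]? = some (.inl (.head q t g b))) :
    k = c.pos ∧ q = c.q ∧ t = u k ∧ g = c.tape k ∧ b = decide (k = 0) := by
  rcases h.cases hk with ⟨_, h⟩ | ⟨h1, h⟩ | ⟨h1, h2, h | h⟩
  · simp at h
  · simp only [Sum.inl.injEq, NT.head.injEq] at h
    exact ⟨h1, h⟩
  · simp at h
  · simp at h

end EncodesCells

theorem getElem?_append_left_eq {α : Type*} (a l v : List α) {j : ℕ} (h : j < a.length) :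
    (a ++ l ++ v)[j]? = a[j]? := by
  rw [List.append_assoc, List.getElem?_append_left h]

theorem getElem?_append_right_eq {α : Type*} {a l l' v : List α} (hl : l.length = l'.length) {j : ℕ}
    (h : a.length + l.length ≤ j) : (a ++ l ++ v)[j]? = (a ++ l' ++ v)[j]? := by
  rw [List.getElem?_append_right (by simpa using h),
    List.getElem?_append_right (by simpa [← hl] using h)]
  simp [hl]

theorem getElem?_replace {α : Type*} {a l l' v : List α} (hl : l.length = l'.length) {j : ℕ}
    (h : j < a.length ∨ a.length + l.length ≤ j) : (a ++ l ++ v)[j]? = (a ++ l' ++ v)[j]? := by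
  rcases h with h | h
  · rw [getElem?_append_left_eq _ _ _ h, getElem?_append_left_eq _ _ _ h]
  · exact getElem?_append_right_eq hl h

theorem Encodes.step {u : ℕ → T} {r : Rule M.Q M.Γ T} (hr : r.Valid M)
    {x y : List (NT M.Q M.Γ T ⊕ T)} {c : Cfg M.Q M.Γ} (h : Encodes M u x c) (hs : RStep M r x y)
    (hy : ∀ j s t, y[j]? = some s → letter s = some t → t = u j) :
    ∃ c', Encodes M u y c' ∧ ((r.state = none ∧ c' = c) ∨
      (r.state = some c.q ∧ TMStep M.trans c c')) := by
  obtain ⟨a, v, hx, rfl⟩ := hs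
  have hx0 : ∀ s, (r.lhs.map Sum.inl : List (NT M.Q M.Γ T ⊕ T))[0]? = some s →
      x[a.length]? = some s := by
    intro s hs
    have h0 : 0 < (r.lhs.map Sum.inl : List (NT M.Q M.Γ T ⊕ T)).length := by
      by_contra hlt
      rw [List.getElem?_eq_none (by omega)] at hs
      simp at hs
    have := getElem?_append_mid a (r.lhs.map Sum.inl) v h0
    rw [hx, ← hs]
    simpa using this
  rcases h with ⟨rfl, rfl⟩ | ⟨n, h⟩
  · have ha : a = [] := by
      rcases a with _ | ⟨z, a⟩
      · rfl
      · cases r <;> simp [Rule.lhs] at hx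
    subst ha
    cases r with
    | init t =>
      obtain rfl : v = [] := by simpa [Rule.lhs] using hx
      have ht : t = u 0 := hy 0 (.inl (.head M.init t (M.embed t) true)) t (by simp [Rule.rhs])
        (by simp)
      subst ht
      refine ⟨_, Or.inr ⟨1, ?_⟩, Or.inl ⟨rfl, rfl⟩⟩
      constructor <;> simp [Rule.rhs]
    | _ => simp [Rule.lhs] at hx
  · cases r with
    | init t => exact (h.false_of_start (hx0 _ (by simp [Rule.lhs]))).elim
    | ext t =>
      have hn := h.eq_of_tail (hx0 _ (by simp [Rule.lhs]))
      have hv : v = [] := by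
        have := h.length
        rw [hx] at this
        simp [Rule.lhs] at this
        exact List.length_eq_zero_iff.mp (by omega)
      subst hv
      have ht : t = u a.length := hy a.length (.inl (.cell t (M.embed t) false)) t
        (by simp [Rule.rhs]) (by simp)
      have hlt : ∀ j < n, (a ++ Rule.rhs M (.ext t) ++ [])[j]? = x[j]? := by
        intro j hj
        rw [getElem?_append_left_eq _ _ _ (by omega), hx, getElem?_append_left_eq _ _ _ (by omega)]
      refine ⟨c, Or.inr ⟨n + 1, ?_⟩, Or.inl ⟨rfl, rfl⟩⟩
      have hpos := h.pos_lt
      refine ⟨by simp [Rule.rhs, hn], ?_, by omega, by rw [hlt _ hpos, h.head], ?_, ?_⟩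
      · simp [Rule.rhs, ← hn]
      · intro j hj hjp
        rcases Nat.lt_succ_iff_lt_or_eq.mp hj with hj | rfl
        · rw [hlt j hj]
          exact h.cell j hj hjp
        · left
          rw [h.fresh j le_rfl, ← hn, ← ht]
          have ha : a ≠ [] := by
            rintro rfl
            simp at hn
            omega
          simp [Rule.rhs, ha]
      · intro j hj
        exact h.fresh j (by omega)
    | out t g b =>
      obtain ⟨hk, hkp, ht, hg, hb⟩ := h.of_cell (hx0 (.inl (.cell t g b)) (by simp [Rule.lhs]))
      have hne : ∀ j, j ≠ a.length → (a ++ Rule.rhs M (.out t g b) ++ v)[j]? = x[j]? := by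
        intro j hj
        rw [hx]
        exact getElem?_replace (by simp [Rule.rhs, Rule.lhs]) (by simp [Rule.rhs]; omega)
      refine ⟨c, Or.inr ⟨n, ?_⟩, Or.inl ⟨rfl, rfl⟩⟩
      have hpos := h.pos_lt
      refine ⟨?_, by rw [hne _ (by omega), h.tail], hpos, by rw [hne _ (Ne.symm hkp), h.head], ?_,
        h.fresh⟩
      · rw [← h.length, hx]; simp [Rule.lhs, Rule.rhs]
      · intro j hj hjp
        by_cases hjk : j = a.length
        · right
          simp [hjk, Rule.rhs, ht]
        · rw [hne j hjk]
          exact h.cell j hj hjp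
    | stay q t g b q' g' =>
      obtain ⟨hk, hq, ht, hg, hb⟩ := h.of_head (hx0 (.inl (.head q t g b)) (by simp [Rule.lhs]))
      have hne : ∀ j, j ≠ a.length → (a ++ Rule.rhs M (.stay q t g b q' g') ++ v)[j]? = x[j]? := by
        intro j hj
        rw [hx]
        exact getElem?_replace (by simp [Rule.rhs, Rule.lhs]) (by simp [Rule.rhs]; omega)
      have hpos := h.pos_lt
      refine ⟨⟨q', Function.update c.tape c.pos g', c.pos⟩, Or.inr ⟨n, ?_⟩,
        Or.inr ⟨by rw [← hq]; rfl, ?_⟩⟩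
      · refine ⟨?_, by rw [hne _ (by omega), h.tail], hpos, ?_, ?_, ?_⟩
        · rw [← h.length, hx]; simp [Rule.lhs, Rule.rhs]
        · simp [← hk, Rule.rhs, ht, hb]
        · intro j hj hjp
          have hjp : j ≠ c.pos := hjp
          rw [hne j (by omega)]
          simpa [Function.update_of_ne hjp] using h.cell j hj hjp
        · intro j hj
          have hjp : j ≠ c.pos := by omega
          simpa [Function.update_of_ne hjp] using h.fresh j hj
      · rw [hk] at hg hb
        subst hg hq
        rcases hr with hr | ⟨hb', hr⟩
        · exact ⟨g', .S, hr, rfl, rfl⟩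
        · refine ⟨g', .L, hr, rfl, ?_⟩
          simp [hb'] at hb
          simp [moveHead, hb]
    | right q t g b q' g' t₂ g₂ b₂ =>
      obtain ⟨hk, hq, ht, hg, hb⟩ := h.of_head (hx0 (.inl (.head q t g b)) (by simp [Rule.lhs]))
      have hx1 : x[a.length + 1]? = some (.inl (.cell t₂ g₂ b₂)) := by
        rw [hx, getElem?_append_mid _ _ _ (by simp [Rule.lhs])]; simp [Rule.lhs]
      obtain ⟨hk₂, hkp₂, ht₂, hg₂, hb₂⟩ := h.of_cell hx1
      have hne : ∀ j, j ≠ a.length → j ≠ a.length + 1 →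
          (a ++ Rule.rhs M (.right q t g b q' g' t₂ g₂ b₂) ++ v)[j]? = x[j]? := by
        intro j hj hj'
        rw [hx]
        exact getElem?_replace (by simp [Rule.rhs, Rule.lhs]) (by simp [Rule.rhs]; omega)
      have hpos := h.pos_lt
      refine ⟨⟨q', Function.update c.tape c.pos g', c.pos + 1⟩, Or.inr ⟨n, ?_⟩,
        Or.inr ⟨by rw [← hq]; rfl, ?_⟩⟩
      · refine ⟨?_, by rw [hne _ (by omega) (by omega), h.tail], by simp; omega, ?_, ?_, ?_⟩
        · rw [← h.length, hx]; simp [Rule.lhs, Rule.rhs]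
        · show (_ : List _)[c.pos + 1]? = _
          rw [← hk, getElem?_append_mid _ _ _ (by simp [Rule.rhs])]
          simp [ Rule.rhs, ht₂, hg₂, hb₂]
        · intro j hj hjp
          have hjp : j ≠ c.pos + 1 := hjp
          by_cases hjk : j = c.pos
          · left
            simp [hjk, ← hk, Rule.rhs, ht, hb]
          · rw [hne j (by omega) (by omega)]
            simpa [Function.update_of_ne hjk] using h.cell j hj hjk
        · intro j hj
          have hjp : j ≠ c.pos := by omega
          simpa [Function.update_of_ne hjp] using h.fresh j hj
      · rw [hk] at hg
        subst hg hq
        exact ⟨g', .R, hr, rfl, rfl⟩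
    | left q t g b q' g' t₂ g₂ b₂ =>
      obtain ⟨hk₂, hkp₂, ht₂, hg₂, hb₂⟩ := h.of_cell (hx0 (.inl (.cell t₂ g₂ b₂)) (by simp [Rule.lhs]))
      have hx1 : x[a.length + 1]? = some (.inl (.head q t g b)) := by
        rw [hx, getElem?_append_mid _ _ _ (by simp [Rule.lhs])]; simp [Rule.lhs]
      obtain ⟨hk, hq, ht, hg, hb⟩ := h.of_head hx1
      have hne : ∀ j, j ≠ a.length → j ≠ a.length + 1 →
          (a ++ Rule.rhs M (.left q t g b q' g' t₂ g₂ b₂) ++ v)[j]? = x[j]? := by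
        intro j hj hj'
        rw [hx]
        exact getElem?_replace (by simp [Rule.rhs, Rule.lhs]) (by simp [Rule.rhs]; omega)
      have hpos := h.pos_lt
      refine ⟨⟨q', Function.update c.tape c.pos g', a.length⟩, Or.inr ⟨n, ?_⟩,
        Or.inr ⟨by rw [← hq]; rfl, ?_⟩⟩
      · refine ⟨?_, by rw [hne _ (by omega) (by omega), h.tail], hk₂, ?_, ?_, ?_⟩
        · rw [← h.length, hx]; simp [Rule.lhs, Rule.rhs]
        · simp [Function.update_of_ne hkp₂, Rule.rhs, ht₂, hg₂, hb₂]
        · intro j hj hjp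
          have hjp : j ≠ a.length := hjp
          by_cases hjk : j = c.pos
          · left
            rw [hjk, ← hk, getElem?_append_mid _ _ _ (by simp [Rule.rhs])]
            simp [Rule.rhs, ht, hb]
          · rw [hne j (by omega) (by omega)]
            simpa [Function.update_of_ne hjk] using h.cell j hj hjk
        · intro j hj
          have hjp : j ≠ c.pos := by omega
          simpa [Function.update_of_ne hjp] using h.fresh j hj
      · rw [hk] at hg
        subst hg hq
        exact ⟨g', .L, hr, rfl, by simp [moveHead, ← hk]⟩

end TMGrammar

namespace TMGrammar

variable {T : Type} {M : OmegaTM T} {u : ℕ → T}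

theorem Encodes.length_termPrefix_le {x : List (NT M.Q M.Γ T ⊕ T)} {c : Cfg M.Q M.Γ}
    (h : Encodes M u x c) : (termPrefix x).length ≤ c.pos := by
  rcases h with ⟨rfl, rfl⟩ | ⟨n, h⟩
  · simp [termPrefix]
  · exact termPrefix_length_le h.head

theorem getElem?_filterMap_letter {Q Γ : Type} {x : List (NT Q Γ T ⊕ T)} {j : ℕ} {t : T}
    (h : (termPrefix x)[j]? = some t) : (x.filterMap letter)[j]? = some t := by
  induction x generalizing j with
  | nil => simp [termPrefix] at h
  | cons a x ih =>
    rcases a with A | a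
    · simp [termPrefix] at h
    · rcases j with _ | j
      · simpa [termPrefix] using h
      · simpa using ih (by simpa [termPrefix] using h)

/-- In a derivation whose terminal prefixes grow to `u`, every symbol carries the letter of `u` at
its position. -/
theorem letter_eq {s : ℕ → List (NT M.Q M.Γ T ⊕ T)} (hS : ∀ i, Shape (s i))
    (hp : ∀ i, (s i).filterMap letter <+: (s (i + 1)).filterMap letter)
    (hgrow : ∀ n : ℕ, ∃ i : ℕ, n ≤ (termPrefix (s i)).length)
    (hmatch : ∀ i : ℕ, MatchesPrefix (termPrefix (s i)) u)
    {i j : ℕ} {a : NT M.Q M.Γ T ⊕ T} {t : T} (ha : (s i)[j]? = some a) (ht : letter a = some t) :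
    t = u j := by
  have hpm : ∀ {i k}, i ≤ k → (s i).filterMap letter <+: (s k).filterMap letter := by
    intro i k hik
    induction k, hik using Nat.le_induction with
    | base => exact List.prefix_rfl
    | succ k _ ih => exact ih.trans (hp k)
  have h1 := (hS i).getElem?_filterMap ha ht
  obtain ⟨k, hk⟩ := hgrow (j + 1)
  have h2 := List.getElem?_eq_getElem (show j < (termPrefix (s k)).length by omega)
  have h3 := matchesPrefix_iff.mp (hmatch k) _ _ h2
  have h4 := getElem?_filterMap_letter h2
  have key : ∀ {l l' : List T} {a : T}, l <+: l' → l[j]? = some a → l'[j]? = some a := by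
    rintro l _ a ⟨l', rfl⟩ h
    obtain ⟨hlt, -⟩ := List.getElem?_eq_some_iff.mp h
    rw [List.getElem?_append_left hlt, h]
  have h5 := key (hpm (le_max_left i k)) h1
  rw [key (hpm (le_max_right i k)) h4, Option.some_inj] at h5
  rw [← h5, h3]

theorem mem_lang_of_mem_grammar_lang [Fintype T] {σ : AccSigma} {ρ : AccRho}
    (hu : u ∈ (grammar M ρ).Lang σ ρ .nl) : u ∈ M.Lang σ ρ := by
  obtain ⟨s, d, h0, hs, hgrow, hmatch, hacc⟩ := hu
  change ℕ → List (NT M.Q M.Γ T ⊕ T) at s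
  change ℕ → {r : Rule M.Q M.Γ T // r.Valid M} at d
  change s 0 = [.inl .start] at h0
  have hR : ∀ i, RStep M (d i).1 (s i) (s (i + 1)) := hs
  have hS : ∀ i, Shape (s i) := by
    intro i
    induction i with
    | zero => rw [h0]; simp [Shape]
    | succ i ih => exact ((hR i).shape ih).1
  have hlet := fun i j a t => letter_eq (i := i) (j := j) (a := a) (t := t) hS
    (fun i => ((hR i).shape (hS i)).2) hgrow hmatch
  obtain ⟨A, hA0, hA⟩ := exists_seq_of_invariant (fun i c => Encodes M u (s i) c)
    (fun i c c' => ((d i).1.state = none ∧ c' = c) ∨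
      ((d i).1.state = some c.q ∧ TMStep M.trans c c'))
    ⟨M.init, fun n => M.embed (u n), 0⟩ (Or.inl ⟨h0, rfl⟩)
    (fun i c hc => hc.step (d i).2 (hR i) (hlet (i + 1)))
  have hge : ∀ n, ∃ i0, ∀ i ≥ i0, n ≤ (A i).pos := by
    intro n
    obtain ⟨i0, hi0⟩ := hgrow n
    refine ⟨i0, fun i hi => ?_⟩
    have h1 := (OmegaPSG.termPrefix_grows_of_le (G := grammar M ρ) hs hi).length_le
    have h2 := (hA i).1.length_termPrefix_le
    exact (hi0.trans h1).trans h2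
  have hinf : ∀ n, ∃ i, n ≤ i ∧ (d i).1.state ≠ none := by
    intro n
    by_contra! hcon
    have hconst : ∀ i ≥ n, A i = A n := by
      intro i hi
      induction i, hi using Nat.le_induction with
      | base => rfl
      | succ i hi ih =>
        rcases (hA i).2 with ⟨_, h⟩ | ⟨h, _⟩
        · rw [h, ih]
        · rw [hcon i hi] at h; simp at h
    obtain ⟨i0, hi0⟩ := hge ((A n).pos + 1)
    have := hi0 (max n i0) (le_max_right _ _)
    rw [hconst _ (le_max_left _ _)] at this
    omega
  obtain ⟨c, q, lev, hst, hAc, hc⟩ := exists_unstutter A (fun i => (d i).1.state)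
    (fun q c c' => c.q = q ∧ TMStep M.trans c c') (fun i => by
      rcases (hA i).2 with h | ⟨h, h'⟩
      · exact Or.inl h
      · exact Or.inr ⟨_, h, rfl, h'⟩) hinf
  rw [OmegaTM.mem_Lang_iff]
  refine ⟨c, ?_, fun k => (hc k).2, ?_, ?_, ?_⟩
  · rw [← hA0, hAc, hst.zero]
  · intro n
    obtain ⟨i0, hi0⟩ := hge n
    exact ⟨lev i0, by rw [← hAc]; exact hi0 i0 le_rfl⟩
  · intro n
    obtain ⟨i0, hi0⟩ := hge (n + 1)
    refine ⟨lev i0 + 1, fun k hk => ?_⟩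
    obtain ⟨i, hi, -⟩ := hst.exists_jump k
    have hlt : i0 ≤ i := by
      by_contra! hlt
      have := hst.mono hlt.le
      omega
    have := hi0 i hlt
    rw [hAc, hi] at this
    omega
  · have hq : (fun k => (c k).q) = q := funext fun k => (hc k).1
    rw [hq]
    have : Finite {r : Rule M.Q M.Γ T // r.Valid M} :=
      @Finite.of_fintype _ (grammar M ρ).fintypeP
    exact (hst.isAccepting_iff (h := fun r : {r : Rule M.Q M.Γ T // r.Valid M} => r.1.state)
      σ ρ M.acc).mp hacc

end TMGrammar

namespace TMGrammar

variable {T : Type} {M : OmegaTM T} {u : ℕ → T}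

open Classical in
/-- The symbol at position `j` of the form encoding `c`, where the cells in `D` are done. -/
noncomputable def symb (u : ℕ → T) (c : Cfg M.Q M.Γ) (D : Set ℕ) (j : ℕ) : NT M.Q M.Γ T ⊕ T :=
  if j = c.pos then .inl (.head c.q (u j) (c.tape j) (decide (j = 0)))
  else if j ∈ D then .inr (u j) else .inl (.cell (u j) (c.tape j) (decide (j = 0)))

/-- The form with `n` cells encoding `c`, where the cells in `D` are done. -/
noncomputable def form (u : ℕ → T) (c : Cfg M.Q M.Γ) (D : Set ℕ) (n : ℕ) :
    List (NT M.Q M.Γ T ⊕ T) :=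
  window (symb u c D) 0 n ++ [.inl .tail]

theorem symb_pos (c : Cfg M.Q M.Γ) (D : Set ℕ) :
    symb u c D c.pos = .inl (.head c.q (u c.pos) (c.tape c.pos) (decide (c.pos = 0))) :=
  if_pos rfl

theorem symb_cell {c : Cfg M.Q M.Γ} {D : Set ℕ} {j : ℕ} (h : j ≠ c.pos) (h' : j ∉ D) :
    symb u c D j = .inl (.cell (u j) (c.tape j) (decide (j = 0))) := by
  rw [symb, if_neg h, if_neg h']

theorem symb_mem {c : Cfg M.Q M.Γ} {D : Set ℕ} {j : ℕ} (h : j ≠ c.pos) (h' : j ∈ D) :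
    symb u c D j = .inr (u j) := by
  rw [symb, if_neg h, if_pos h']

open Classical in
theorem symb_congr {c c' : Cfg M.Q M.Γ} {D D' : Set ℕ} {j : ℕ} (h : j ≠ c.pos) (h' : j ≠ c'.pos)
    (hD : j ∈ D ↔ j ∈ D') (ht : c.tape j = c'.tape j) : symb u c D j = symb u c' D' j := by
  rw [symb, symb, if_neg h, if_neg h', ht]
  exact if_congr hD rfl rfl

theorem eq_of_form_getElem? {c : Cfg M.Q M.Γ} {D : Set ℕ} {n j : ℕ} {t : T}
    (h : (form u c D n)[j]? = some (.inr t)) : t = u j := by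
  rcases lt_or_ge j n with hj | hj
  · rw [form, List.getElem?_append_left (by simpa using hj), getElem?_window hj, Nat.zero_add,
      Option.some_inj, symb] at h
    split_ifs at h
    exact (Sum.inr.inj h).symm
  · rw [form, List.getElem?_append_right (by simpa using hj)] at h
    have := List.mem_of_getElem? h
    simp at this

theorem rStep_window {r : Rule M.Q M.Γ T} {f g : ℕ → NT M.Q M.Γ T ⊕ T} {p a n : ℕ}
    (hl : r.lhs.map Sum.inl = window f p a) (hr : r.rhs M = window g p a) (hn : p + a ≤ n)
    (hfg : ∀ j, j < p ∨ p + a ≤ j → f j = g j) (z : NT M.Q M.Γ T ⊕ T) :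
    RStep M r (window f 0 n ++ [z]) (window g 0 n ++ [z]) := by
  obtain ⟨b, rfl⟩ := Nat.exists_eq_add_of_le hn
  refine ⟨window f 0 p, window f (p + a) b ++ [z], ?_, ?_⟩
  · simp [hl, window_add]
  · have h1 : window f 0 p = window g 0 p := window_congr fun j _ hj => hfg j (by omega)
    have h2 : window f (p + a) b = window g (p + a) b := window_congr fun j hj _ => hfg j (by omega)
    simp [hr, window_add, h1, h2]

theorem rStep_init (c : Cfg M.Q M.Γ) (hc : c = ⟨M.init, fun n => M.embed (u n), 0⟩) (D : Set ℕ) :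
    RStep M (.init (u 0)) [.inl .start] (form u c D 1) := by
  subst hc
  refine ⟨[], [], by simp [Rule.lhs], ?_⟩
  simp [form, window_one, symb, Rule.rhs]

theorem rStep_ext {c : Cfg M.Q M.Γ} {D : Set ℕ} {n : ℕ} (hn : n ≠ 0) (hp : n ≠ c.pos) (hD : n ∉ D)
    (ht : c.tape n = M.embed (u n)) : RStep M (.ext (u n)) (form u c D n) (form u c D (n + 1)) := by
  refine ⟨window (symb u c D) 0 n, [], by simp [Rule.lhs, form], ?_⟩
  simp [form, window_succ, symb_cell hp hD, Rule.rhs, ht, hn]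

theorem rStep_out {c : Cfg M.Q M.Γ} {D D' : Set ℕ} {n p : ℕ} (hn : p < n) (hp : p ≠ c.pos)
    (hD : p ∉ D) (hD' : p ∈ D') (h : ∀ j, j ≠ p → (j ∈ D ↔ j ∈ D')) :
    RStep M (.out (u p) (c.tape p) (decide (p = 0))) (form u c D n) (form u c D' n) := by
  refine rStep_window (p := p) (a := 1) ?_ ?_ hn ?_ _
  · simp [window_one, symb_cell hp hD, Rule.lhs]
  · simp [window_one, symb_mem hp hD', Rule.rhs]
  · intro j hj
    by_cases hjp : j = c.pos
    · subst hjp; rw [symb_pos, symb_pos]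
    · exact symb_congr hjp hjp (h j (by omega)) rfl

theorem exists_rStep_of_tmStep {c c' : Cfg M.Q M.Γ} {D : Set ℕ} {n : ℕ}
    (h : TMStep M.trans c c') (hn : c.pos + 1 < n) (hD : c.pos ∉ D) (hD' : c'.pos ∉ D) :
    ∃ r : Rule M.Q M.Γ T, r.Valid M ∧ r.state = some c.q ∧
      RStep M r (form u c D n) (form u c' D n) := by
  obtain ⟨q, tape, p⟩ := c
  obtain ⟨q', tape', p'⟩ := c'
  obtain ⟨g, m, htr, rfl, rfl⟩ := h
  simp only at htr hn hD hD'
  have hstay : ∀ m : Move, moveHead m p = p → RStep M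
      (.stay q (u p) (tape p) (decide (p = 0)) q' g) (form u ⟨q, tape, p⟩ D n)
      (form u ⟨q', Function.update tape p g, moveHead m p⟩ D n) := by
    intro m hm
    rw [hm]
    refine rStep_window (p := p) (a := 1) ?_ ?_ (by omega) ?_ _
    · simp [window_one, symb, Rule.lhs]
    · simp [window_one, symb, Rule.rhs]
    · intro j hj
      have hjp : j ≠ p := by omega
      exact symb_congr hjp hjp Iff.rfl (by simp [hjp])
  cases m with
  | S => exact ⟨.stay .., Or.inl htr, rfl, hstay .S rfl⟩
  | L =>
    rcases p with _ | p
    · exact ⟨.stay .., Or.inr ⟨rfl, htr⟩, rfl, hstay .L rfl⟩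
    · refine ⟨.left q (u (p + 1)) (tape (p + 1)) false q' g (u p) (tape p) (decide (p = 0)), htr, rfl,
        rStep_window (p := p) (a := 2) ?_ ?_ (by omega) ?_ _⟩
      · have hD' : p ∉ D := hD'
        simp [window_succ', symb, Rule.lhs, hD']
      · simp [window_succ', symb, Rule.rhs, moveHead, hD]
      · intro j hj
        have hjp : j ≠ p + 1 := by omega
        exact symb_congr hjp (by simp [moveHead]; omega) Iff.rfl (by simp [hjp])
  | R =>
    refine ⟨.right q (u p) (tape p) (decide (p = 0)) q' g (u (p + 1)) (tape (p + 1)) false, htr, rfl,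
        rStep_window (p := p) (a := 2) ?_ ?_ (by omega) ?_ _⟩
    · have hD' : p + 1 ∉ D := hD'
      simp [window_succ', symb, Rule.lhs, hD']
    · simp [window_succ', symb, Rule.rhs, moveHead, hD]
    · intro j hj
      have hjp : j ≠ p := by omega
      exact symb_congr hjp (by simp [moveHead]; omega) Iff.rfl (by simp [hjp])

/-- The cells visited before step `k` and never again. -/
def doneCells (pos : ℕ → ℕ) (k : ℕ) : Set ℕ := {j | (∃ i < k, pos i = j) ∧ ∀ i, k ≤ i → pos i ≠ j}

theorem doneCells_succ {pos : ℕ → ℕ} {k j : ℕ} (h : j ≠ pos k) :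
    j ∈ doneCells pos k ↔ j ∈ doneCells pos (k + 1) := by
  constructor
  · rintro ⟨⟨i, hi, hij⟩, hk⟩
    exact ⟨⟨i, by omega, hij⟩, fun i hi => hk i (by omega)⟩
  · rintro ⟨⟨i, hi, hij⟩, hk⟩
    refine ⟨⟨i, ?_, hij⟩, fun i hi => ?_⟩
    · rcases Nat.lt_succ_iff_lt_or_eq.mp hi with hi | rfl
      · exact hi
      · exact (h hij.symm).elim
    · rcases Nat.lt_or_ge k i with hi' | hi'
      · exact hk i hi'
      · obtain rfl : k = i := le_antisymm hi hi'
        exact h.symm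

theorem notMem_doneCells {pos : ℕ → ℕ} {k i : ℕ} (h : k ≤ i) : pos i ∉ doneCells pos k :=
  fun hk => hk.2 i h rfl

theorem exists_eq_of_le {pos : ℕ → ℕ} (h0 : pos 0 = 0) (h : ∀ i, pos (i + 1) ≤ pos i + 1) {i j : ℕ}
    (hj : j ≤ pos i) : ∃ i' ≤ i, pos i' = j := by
  induction i with
  | zero => exact ⟨0, le_rfl, by omega⟩
  | succ i ih =>
    rcases Nat.lt_or_ge (pos i) j with hlt | hle
    · exact ⟨i + 1, le_rfl, by have := h i; omega⟩
    · obtain ⟨i', hi', hp⟩ := ih hle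
      exact ⟨i', by omega, hp⟩

theorem eventually_subset_doneCells {pos : ℕ → ℕ} (h0 : pos 0 = 0)
    (h : ∀ i, pos (i + 1) ≤ pos i + 1) (hcomp : ∀ n, ∃ i, n ≤ pos i)
    (hosc : ∀ n, ∃ i0, ∀ i, i0 ≤ i → pos i ≠ n) (n : ℕ) :
    ∃ k, n ≤ k ∧ ∀ j < n, j ∈ doneCells pos k := by
  obtain ⟨i1, hi1⟩ := hcomp n
  choose i0 hi0 using hosc
  refine ⟨n + (i1 + 1) + ∑ j ∈ Finset.range n, i0 j, by omega, fun j hj => ⟨?_, ?_⟩⟩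
  · obtain ⟨i, hi, hp⟩ := exists_eq_of_le h0 h (i := i1) (j := j) (by omega)
    exact ⟨i, by omega, hp⟩
  · intro i hi
    have := Finset.single_le_sum (f := i0) (fun _ _ => Nat.zero_le _) (Finset.mem_range.mpr hj)
    exact hi0 j i (by omega)

theorem mem_grammar_lang_of_mem_lang [Fintype T] {σ : AccSigma} {ρ : AccRho}
    (hu : u ∈ M.Lang σ ρ) : u ∈ (grammar M ρ).Lang σ ρ .nl := by
  obtain ⟨c, h0, hs, hcomp, hosc, hacc⟩ := (M.mem_Lang_iff σ ρ u).mp hu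
  have hsucc : ∀ i, (c (i + 1)).pos ≤ (c i).pos + 1 := by
    intro i
    obtain ⟨g, m, -, -, h⟩ := hs i
    rw [h]
    exact moveHead_le _ _
  have hpos : ∀ k, (c k).pos ≤ k := by
    intro k
    induction k with
    | zero => simp [h0]
    | succ k ih => have := hsucc k; omega
  have htape : ∀ k j, k ≤ j → (c k).tape j = M.embed (u j) := by
    intro k
    induction k with
    | zero => simp [h0]
    | succ k ih =>
      intro j hj
      obtain ⟨g, m, -, h, -⟩ := hs k
      have := hpos k
      rw [h, Function.update_of_ne (by omega), ih j (by omega)]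
  set pos : ℕ → ℕ := fun i => (c i).pos with hposdef
  set D := doneCells pos with hD
  have hDlt : ∀ k j, j ∈ D k → j < k := by
    rintro k j ⟨⟨i, hi, rfl⟩, -⟩
    exact (hpos i).trans_lt hi
  let C' : ℕ → List (NT M.Q M.Γ T ⊕ T) := fun k => form u (c k) (D k) (k + 2)
  let C : ℕ → List (NT M.Q M.Γ T ⊕ T) := fun k => match k with
    | 0 => [.inl .start]
    | k + 1 => form u (c (k + 1)) (D k) (k + 2)
  let Good : List (NT M.Q M.Γ T ⊕ T) → Prop := fun x => ∀ j t, x[j]? = some (.inr t) → t = u j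
  have hGood : ∀ c D n, Good (form u c D n) := fun c D n j t h => eq_of_form_getElem? h
  have hext : ∀ k, RStep M (.ext (u (k + 1))) (form u (c k) (D k) (k + 1)) (C' k) := by
    intro k
    refine rStep_ext (by omega) (by have := hpos k; omega) (fun h => ?_) (htape k _ (by omega))
    have := hDlt _ _ h
    omega
  obtain ⟨f, lev, hf0, hlev0, hunb, hf⟩ := exists_concat
    (fun _ x y => Good x ∧ ∃ r : Rule M.Q M.Γ T, r.Valid M ∧ r.state = none ∧ RStep M r x y)
    (fun k x y => x = C' k ∧ ∃ r : Rule M.Q M.Γ T, r.Valid M ∧ r.state = some (c k).q ∧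
      RStep M r x y) C C' (by
        rintro (_ | k)
        · refine .head (b := form u (c 0) (D 0) 1) ⟨?_, .init _, trivial, rfl, rStep_init _ h0 _⟩
            (.single ⟨hGood _ _ _, .ext _, trivial, rfl, hext 0⟩)
          intro j t h
          have := List.mem_of_getElem? h
          simp [C] at this
        · refine .tail (b := form u (c (k + 1)) (D (k + 1)) (k + 2)) ?_
            ⟨hGood _ _ _, .ext _, trivial, rfl, hext (k + 1)⟩
          by_cases hk : pos k ∈ D (k + 1)
          · refine .single ⟨hGood _ _ _, .out _ _ _, trivial, rfl, rStep_out (p := pos k) ?_ ?_ ?_ hk ?_⟩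
            · exact (hpos k).trans_lt (by omega)
            · exact (hk.2 (k + 1) le_rfl).symm
            · exact notMem_doneCells le_rfl
            · exact fun j hj => doneCells_succ hj
          · have : D (k + 1) = D k := by
              ext j
              by_cases hj : j = pos k
              · subst hj
                exact iff_of_false hk (notMem_doneCells le_rfl)
              · exact (doneCells_succ hj).symm
            rw [this])
      (fun k => ⟨rfl, exists_rStep_of_tmStep (hs k) (by have := hpos k; omega)
        (notMem_doneCells (pos := pos) le_rfl)
        (notMem_doneCells (pos := pos) (i := k + 1) (by omega))⟩)
  have hf' : ∀ i, ∃ r : {r : Rule M.Q M.Γ T // r.Valid M}, RStep M r.1 (f i) (f (i + 1)) ∧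
      Good (f i) ∧ ((r.1.state = none ∧ lev (i + 1) = lev i) ∨
        (r.1.state = some (c (lev i)).q ∧ lev (i + 1) = lev i + 1)) := by
    intro i
    rcases hf i with ⟨⟨hg, r, hr, hr', hs⟩, hl⟩ | ⟨⟨hg, r, hr, hr', hs⟩, hl⟩
    · exact ⟨⟨r, hr⟩, hs, hg, Or.inl ⟨hr', hl⟩⟩
    · exact ⟨⟨r, hr⟩, hs, by rw [hg]; exact hGood _ _ _, Or.inr ⟨hr', hl⟩⟩
  choose d hd hg hst using hf'
  have H : Stutter (fun i => (d i).1.state) (fun k => (c k).q) lev := ⟨hlev0, hunb, hst⟩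
  refine ⟨f, d, hf0, hd, ?_, ?_, ?_⟩
  · intro n
    obtain ⟨k, hnk, hk⟩ := eventually_subset_doneCells (pos := pos) (by simp [hposdef, h0]) hsucc
      hcomp hosc n
    obtain ⟨i, hi, hi', -⟩ := H.exists_jump k
    have hfi : f i = C' k := by
      rcases hf i with ⟨-, h⟩ | ⟨⟨h, -⟩, -⟩
      · omega
      · rw [h, hi]
    refine ⟨i, ?_⟩
    rw [hfi]
    refine le_length_termPrefix fun j hj => ⟨u j, ?_⟩
    change (window (symb u (c k) (D k)) 0 (k + 2) ++ [(.inl .tail : NT M.Q M.Γ T ⊕ T)])[j]? = _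
    rw [List.getElem?_append_left (by simp; omega), getElem?_window (by omega), Nat.zero_add,
      symb_mem ((hk j hj).2 k le_rfl).symm (hk j hj)]
    rfl
  · intro i
    rw [matchesPrefix_iff]
    exact fun j t h => hg i j t (getElem?_of_termPrefix h)
  · have : Finite {r : Rule M.Q M.Γ T // r.Valid M} :=
      @Finite.of_fintype _ (grammar M ρ).fintypeP
    exact (H.isAccepting_iff (h := fun r : {r : Rule M.Q M.Γ T // r.Valid M} => r.1.state)
      σ ρ M.acc).mpr hacc

theorem grammar_lang [Fintype T] (M : OmegaTM T) (σ : AccSigma) (ρ : AccRho) :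
    (grammar M ρ).Lang σ ρ .nl = M.Lang σ ρ :=
  Set.ext fun _ => ⟨mem_lang_of_mem_grammar_lang, mem_grammar_lang_of_mem_lang⟩

end TMGrammar

/-! ### From grammars to Turing machines -/

namespace GrammarTM

variable {T : Type} (G : OmegaPSG T)

/-- Contents of a cell of the work track. -/
abbrev Sy : Type := Option (G.N ⊕ T)

/-- Tape alphabet: an input letter, the work track, and a marker. -/
abbrev Ga : Type := T × Sy G × Bool

/-- States of the machine simulating `G`. In the state `shift p r w c`, a left-hand side is being
replaced: `r` is the list of symbols expected next, `w` the list of symbols to be written next, and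
`c` bounds the number of blanks that may still be read. -/
inductive St
  | init
  | home
  | adv
  | ret
  | copy (p : G.P)
  | done (p : G.P)
  | shift (p : G.P) (r w : List (Sy G)) (c : ℕ)

variable {G}

/-- The production whose application is completed in a state. -/
def St.label : St G → Option G.P
  | .done p => some p
  | _ => none

/-- The bounds satisfied by the reachable states. -/
def St.Valid : St G → Prop
  | .shift p r w c =>
    r.length = (G.lhs p).length ∧ w.length = (G.rhs p).length ∧ c ≤ (G.rhs p).length
  | _ => True

theorem finite_valid [Finite T] : Finite {s : St G // s.Valid} := by
  have : Finite G.N := @Finite.of_fintype _ G.fintypeN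
  have : Finite G.P := @Finite.of_fintype _ G.fintypeP
  have hP : ∀ f : G.P → St G, (Set.range f).Finite := fun f => Set.finite_range f
  have hsh : (⋃ p : G.P, Set.image
      (fun z : List (Sy G) × List (Sy G) × ℕ => St.shift p z.1 z.2.1 z.2.2)
      ({r | r.length = (G.lhs p).length} ×ˢ {w | w.length = (G.rhs p).length} ×ˢ
        Set.Iic (G.rhs p).length)).Finite :=
    Set.finite_iUnion fun p => Set.Finite.image _ <|
      (List.finite_length_eq _ _).prod ((List.finite_length_eq _ _).prod (Set.finite_Iic _))
  refine Set.Finite.to_subtype (s := {s : St G | s.Valid}) <|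
    ((((Set.toFinite {St.init, St.home, St.adv, St.ret}).union (hP St.copy)).union
      (hP St.done)).union hsh).subset ?_
  rintro (_ | _ | _ | _ | p | p | ⟨p, r, w, c⟩) hs
  · simp
  · simp
  · simp
  · simp
  · simp
  · simp
  · exact Or.inr (Set.mem_iUnion.mpr ⟨p, (r, w, c), hs, rfl⟩)

variable (G) in
/-- Transitions of the machine simulating `G`. -/
inductive Trans : St G → Ga G → St G → Ga G → Move → Prop
  | init (t x m) : Trans .init (t, x, m) .home (t, some (.inl G.start), true) .S
  | out (t) : Trans .home (t, some (.inr t), true) .adv (t, some (.inr t), false) .R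
  | adv (t x m) : Trans .adv (t, x, m) .home (t, x, true) .S
  | pick (p t x) : Trans .home (t, x, true) (.copy p) (t, x, true) .S
  | copy (p t a m) : Trans (.copy p) (t, some a, m) (.copy p) (t, some a, m) .R
  | start (p t x m) : Trans (.copy p) (t, x, m)
      (.shift p ((G.lhs p).map fun A => some (.inl A)) ((G.rhs p).map some) (G.rhs p).length)
      (t, x, m) .S
  | shift {p r w c r' w' c'} (t x m y z) : r ++ [z] = x :: r' → w ++ [z] = y :: w' →
      (x ≠ none ∧ c' = c ∨ x = none ∧ c' + 1 = c) →
      Trans (.shift p r w c) (t, x, m) (.shift p r' w' c') (t, y, m) .R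
  | finish {p r w c} (t m) : (∀ o ∈ r, o = none) → (∀ o ∈ w, o = none) →
      Trans (.shift p r w c) (t, none, m) (.done p) (t, none, m) .S
  | done (p g) : Trans (.done p) g .ret g .S
  | left (t x) : Trans .ret (t, x, false) .ret (t, x, false) .L
  | back (t x) : Trans .ret (t, x, true) .home (t, x, true) .S

theorem Trans.valid {s s' : St G} {g g' : Ga G} {m : Move} (h : Trans G s g s' g' m)
    (hs : s.Valid) : s'.Valid := by
  cases h with
  | start => simp [St.Valid]
  | shift t x m y z hr hw hc =>
    have h1 := congrArg List.length hr
    have h2 := congrArg List.length hw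
    simp only [List.length_append, List.length_cons, List.length_nil] at h1 h2
    obtain ⟨h3, h4, h5⟩ := hs
    exact ⟨by omega, by omega, by omega⟩
  | _ => trivial

variable (G) in
/-- The machine simulating `G` in acceptance mode `(_, ρ)`. -/
noncomputable def machine [Fintype T] (ρ : AccRho) : OmegaTM T :=
  letI := G.fintypeN
  letI := finite_valid (G := G)
  { Q := {s : St G // s.Valid}
    fintypeQ := Fintype.ofFinite _
    Γ := Ga G
    fintypeΓ := Fintype.ofFinite _
    embed := fun t => (t, none, false)
    embed_inj := fun _ _ h => congrArg Prod.fst h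
    init := ⟨.init, trivial⟩
    trans := fun q g q' g' m => Trans G q.1 g q'.1 g' m
    acc := pullAcc ρ (fun q => q.1.label) G.acc }

/-! #### Soundness -/

theorem exists_of_map_some_append {α : Type*} {x l : List α} {e z : List (Option α)}
    (he : ∀ o ∈ e, o = none) (h : x.map some ++ e = l.map some ++ z) :
    ∃ v e', x = l ++ v ∧ z = v.map some ++ e' ∧ ∀ o ∈ e', o = none := by
  induction l generalizing x with
  | nil => exact ⟨x, e, rfl, by simpa using h.symm, he⟩
  | cons a l ih =>
    rcases x with _ | ⟨b, x⟩
    · rcases e with _ | ⟨o, e⟩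
      · simp at h
      · have := he o (by simp)
        simp [this] at h
    · simp only [List.map_cons, List.cons_append, List.cons.injEq, Option.some_inj] at h
      obtain ⟨rfl, h⟩ := h
      obtain ⟨v, e', rfl, hz⟩ := ih h
      exact ⟨v, e', rfl, hz⟩

theorem eq_getElem?_of_map_some_append {α : Type*} {x : List α} {e : List (Option α)}
    (he : ∀ o ∈ e, o = none) {n : ℕ} {o : Option α} (h : (x.map some ++ e)[n]? = some o) :
    o = x[n]? := by
  rcases lt_or_ge n x.length with hn | hn
  · rw [List.getElem?_append_left (by simpa using hn)] at h
    simp [List.getElem?_eq_getElem hn] at h ⊢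
    exact h.symm
  · rw [List.getElem?_append_right (by simpa using hn)] at h
    rw [he o (List.mem_of_getElem? h), List.getElem?_eq_none hn]

theorem window_getElem? {α : Type*} {x : List α} {k : ℕ} (h : k ≤ x.length) :
    window (fun n => x[n]?) 0 k = (x.take k).map some := by
  apply List.ext_getElem
  · simp [h]
  · intro i h1 h2
    simp only [length_window] at h1
    simp [window, List.getElem?_eq_getElem (show i < x.length by omega)]

theorem exists_window_getElem?_eq {α : Type*} {x : List α} {k : ℕ} (h : x.length ≤ k) :
    ∃ e, window (fun n => x[n]?) 0 k = x.map some ++ e ∧ ∀ o ∈ e, o = none := by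
  obtain ⟨b, rfl⟩ := Nat.exists_eq_add_of_le h
  refine ⟨window (fun n => x[n]?) x.length b, ?_, ?_⟩
  · rw [window_add, window_getElem? le_rfl]
    simp
  · intro o ho
    obtain ⟨i, -, rfl⟩ := List.mem_map.mp ho
    exact List.getElem?_eq_none (by omega)

/-- The state-dependent part of the invariant relating the head position and the work track `X` to
the current sentential form `x` and the number `m` of terminals already checked. -/
def StInv (pos : ℕ) (X : ℕ → Sy G) (x : List (G.N ⊕ T)) (m : ℕ) : St G → Prop
  | .init => pos = 0 ∧ (∀ n, X n = none) ∧ x = [.inl G.start] ∧ m = 0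
  | .home => pos = m ∧ ∀ n, X n = x[n]?
  | .adv => pos = m ∧ ∀ n, X n = x[n]?
  | .ret => m ≤ pos ∧ ∀ n, X n = x[n]?
  | .copy _ => m ≤ pos ∧ pos ≤ x.length ∧ ∀ n, X n = x[n]?
  | .done p => m ≤ pos ∧ ∃ y, G.Step p x y ∧ ∀ n, X n = y[n]?
  | .shift p r w c => m ≤ pos ∧ c ≤ (G.rhs p).length ∧ pos + c ≤ x.length + (G.rhs p).length ∧
      (∀ n, pos ≤ n → X n = x[n]?) ∧ ∃ k z,
        window (fun n => x[n]?) 0 pos ++ r =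
          (x.take k ++ (G.lhs p).map Sum.inl).map some ++ z ∧
        window X 0 pos ++ w = (x.take k ++ G.rhs p).map some ++ z

/-- The marker is on the tape. -/
def St.Marked : St G → Prop
  | .init => False
  | .adv => False
  | _ => True

/-- The invariant of the simulation. -/
structure Inv (u : ℕ → T) (c : Cfg (St G) (Ga G)) (x : List (G.N ⊕ T)) (m : ℕ) : Prop where
  input : ∀ n, (c.tape n).1 = u n
  marker : ∀ n, (c.tape n).2.2 = true ↔ n = m ∧ c.q.Marked
  checked : ∀ j < m, x[j]? = some (.inr (u j))
  state : StInv c.pos (fun n => (c.tape n).2.1) x m c.q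

theorem exists_step_of_shift {p : G.P} {r w : List (Sy G)} {c pos m : ℕ} {X : ℕ → Sy G}
    {x : List (G.N ⊕ T)} (h : StInv pos X x m (.shift p r w c)) (hX : X pos = none)
    (hr : ∀ o ∈ r, o = none) (hw : ∀ o ∈ w, o = none) :
    ∃ y, G.Step p x y ∧ ∀ n, X n = y[n]? := by
  obtain ⟨-, -, -, hXx, k, z, h1, h2⟩ := h
  have hlen : x.length ≤ pos := by
    rw [hXx pos le_rfl] at hX
    exact List.getElem?_eq_none_iff.mp hX
  obtain ⟨e, he, he'⟩ := exists_window_getElem?_eq hlen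
  rw [he, List.append_assoc] at h1
  obtain ⟨v, e', hx, rfl, hrest⟩ := exists_of_map_some_append (by
    intro o ho
    rcases List.mem_append.mp ho with ho | ho
    · exact he' o ho
    · exact hr o ho) h1
  refine ⟨x.take k ++ G.rhs p ++ v, ⟨_, _, hx, rfl⟩, fun n => ?_⟩
  rw [← List.append_assoc, ← List.map_append] at h2
  rcases lt_or_ge n pos with hn | hn
  · refine eq_getElem?_of_map_some_append hrest ?_
    rw [← h2, List.getElem?_append_left (by simpa using hn), getElem?_window hn, Nat.zero_add]
  · rw [hXx n hn, List.getElem?_eq_none (by omega), eq_comm, List.getElem?_eq_none_iff]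
    by_contra! hlt
    have h3 : ((x.take k ++ G.rhs p ++ v).map some ++ e')[n]? =
        some (some (x.take k ++ G.rhs p ++ v)[n]) := by
      rw [List.getElem?_append_left (by simpa using hlt), List.getElem?_map,
        List.getElem?_eq_getElem hlt]
      rfl
    rw [← h2, List.getElem?_append_right (by simpa using hn)] at h3
    have := hw _ (List.mem_of_getElem? h3)
    simp at this

theorem checked_of_step {u : ℕ → T} {p : G.P} {x y : List (G.N ⊕ T)} {m : ℕ}
    (h : G.Step p x y) (hx : ∀ j < m, x[j]? = some (.inr (u j))) :
    ∀ j < m, y[j]? = some (.inr (u j)) := by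
  intro j hj
  have hlen : j < (termPrefix x).length :=
    hj.trans_le (le_length_termPrefix fun j hj => ⟨_, hx j hj⟩)
  have h1 := List.getElem?_eq_getElem hlen
  have h2 := getElem?_of_termPrefix h1
  rw [hx j hj, Option.some_inj, Sum.inr.injEq] at h2
  obtain ⟨l, hl⟩ := h.termPrefix_grows
  apply getElem?_of_termPrefix
  rw [← hl, List.getElem?_append_left hlen, h1, h2]

theorem Inv.step {u : ℕ → T} {c c' : Cfg (St G) (Ga G)} {x : List (G.N ⊕ T)} {m : ℕ}
    (h : Inv u c x m) (hs : TMStep (Trans G) c c') :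
    ∃ x' m', Inv u c' x' m' ∧ ((c.q.label = none ∧ x' = x) ∨
      ∃ p, c.q.label = some p ∧ G.Step p x x') := by
  obtain ⟨q, tape, pos⟩ := c
  obtain ⟨q', tape', pos'⟩ := c'
  obtain ⟨g, mv, htr, rfl, rfl⟩ := hs
  obtain ⟨hin, hmk, hch, hst⟩ := h
  simp only at htr hin hmk hst
  have hsame : ∀ q' pos', Trans G q (tape pos) q' (tape pos) mv → q.Marked → q'.Marked →
      StInv pos' (fun n => (tape n).2.1) x m q' →
      Inv u ⟨q', Function.update tape pos (tape pos), pos'⟩ x m := by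
    intro q' pos' _ hq hq' hst'
    rw [Function.update_eq_self]
    exact ⟨hin, fun n => by simp [hmk, hq, hq'], hch, hst'⟩
  generalize hg0 : tape pos = g0 at htr hsame
  have hin' := hin pos
  have hmk' := hmk pos
  rw [hg0] at hin' hmk'
  have hX : (tape pos).2.1 = g0.2.1 := by rw [hg0]
  cases htr with
  | init t y b =>
    obtain ⟨rfl, hX, rfl, rfl⟩ := hst
    refine ⟨_, 0, ⟨?_, ?_, by simp, rfl, ?_⟩, Or.inl ⟨rfl, rfl⟩⟩
    · intro n
      by_cases hn : n = 0
      · simpa [hn] using hin'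
      · simp [hn, hin]
    · intro n
      by_cases hn : n = 0
      · simp [hn, St.Marked]
      · simp [hn, hmk, St.Marked]
    · intro n
      rcases n with _ | n
      · simp
      · simpa using hX (n + 1)
  | out t =>
    obtain ⟨rfl, hX'⟩ := hst
    obtain rfl : t = u pos := hin'
    refine ⟨x, pos + 1, ⟨?_, ?_, ?_, rfl, ?_⟩, Or.inl ⟨rfl, rfl⟩⟩
    · intro n
      by_cases hn : n = pos
      · simp [hn]
      · simp [hn, hin]
    · intro n
      by_cases hn : n = pos
      · simp [hn, St.Marked]
      · simp [hn, hmk, St.Marked]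
    · intro j hj
      rcases Nat.lt_succ_iff_lt_or_eq.mp hj with hj | rfl
      · exact hch j hj
      · exact (hX' j).symm.trans hX
    · intro n
      by_cases hn : n = pos
      · simp [hn, ← hX', hX]
      · simp [hn, hX']
  | adv t y b =>
    obtain ⟨rfl, hX'⟩ := hst
    obtain rfl : t = u pos := hin'
    refine ⟨x, pos, ⟨?_, ?_, hch, rfl, ?_⟩, Or.inl ⟨rfl, rfl⟩⟩
    · intro n
      by_cases hn : n = pos
      · simp [hn]
      · simp [hn, hin]
    · intro n
      by_cases hn : n = pos
      · simp [hn, St.Marked]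
      · simp [hn, hmk, St.Marked]
    · intro n
      by_cases hn : n = pos
      · simp [hn, ← hX', hX]
      · simp [hn, hX']
  | pick p t y =>
    obtain ⟨rfl, hX'⟩ := hst
    refine ⟨x, pos, hsame _ _ (.pick p t y) trivial trivial ⟨le_rfl, ?_, hX'⟩, Or.inl ⟨rfl, rfl⟩⟩
    by_contra! hlt
    have := hch _ hlt
    simp at this
  | copy p t a b =>
    obtain ⟨hm, -, hX'⟩ := hst
    refine ⟨x, m, hsame _ _ (.copy p t a b) trivial trivial ⟨?_, ?_, hX'⟩, Or.inl ⟨rfl, rfl⟩⟩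
    · simp only [moveHead]; omega
    · exact (List.getElem?_eq_some_iff.mp ((hX' pos).symm.trans hX)).1
  | start p t y b =>
    obtain ⟨hm, hle, hX'⟩ := hst
    refine ⟨x, m, hsame _ _ (.start p t y b) trivial trivial ⟨hm, le_rfl, ?_, fun n _ => hX' n,
      pos, [], ?_, ?_⟩, Or.inl ⟨rfl, rfl⟩⟩
    · simp only [moveHead]; omega
    · simp [moveHead, window_getElem? hle]
    · rw [show (fun n => (tape n).2.1) = fun n => x[n]? from funext hX']
      simp [moveHead, window_getElem? hle]
  | @shift p r w c r' w' c' t y b y' z hr hw hc =>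
    obtain ⟨hm, hcle, hpc, hXx, k, z', h1, h2⟩ := hst
    obtain rfl : t = u pos := hin'
    have hy : x[pos]? = y := (hXx pos le_rfl).symm.trans hX
    refine ⟨x, m, ⟨?_, ?_, hch, ?_, ?_, ?_, ?_, k, z' ++ [z], ?_, ?_⟩, Or.inl ⟨rfl, rfl⟩⟩
    · intro n
      by_cases hn : n = pos
      · simp [hn]
      · simp [hn, hin]
    · intro n
      by_cases hn : n = pos
      · simpa [hn, St.Marked] using hmk'
      · simp [hn, hmk, St.Marked]
    · simp only [moveHead]; omega
    · omega
    · simp only [moveHead]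
      rcases hc with ⟨hne, rfl⟩ | ⟨-, rfl⟩
      · have : pos < x.length := by
          by_contra! hlt
          rw [List.getElem?_eq_none hlt] at hy
          exact hne hy.symm
        omega
      · omega
    · intro n hn
      have hn : pos + 1 ≤ n := hn
      simpa [show n ≠ pos by omega] using hXx n (by omega)
    · simp only [moveHead]
      rw [window_succ, Nat.zero_add, hy, List.append_assoc, List.singleton_append, ← hr,
        ← List.append_assoc, h1, List.append_assoc]
    · simp only [moveHead]
      rw [window_succ, Nat.zero_add, window_congr (g := fun n => (tape n).2.1), List.append_assoc]
      · rw [Function.update_self, List.singleton_append, ← hw, ← List.append_assoc, h2,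
          List.append_assoc]
      · intro j _ hj
        simp [show j ≠ pos by omega]
  | finish t b hr hw =>
    exact ⟨x, m, hsame _ _ (.finish t b hr hw) trivial trivial
      ⟨hst.1, exists_step_of_shift hst hX hr hw⟩, Or.inl ⟨rfl, rfl⟩⟩
  | done p g =>
    obtain ⟨hm, y, hy, hX'⟩ := hst
    refine ⟨y, m, ?_, Or.inr ⟨p, rfl, hy⟩⟩
    rw [← hg0, Function.update_eq_self]
    exact ⟨hin, fun n => by simp [hmk, St.Marked], checked_of_step hy hch, hm, hX'⟩
  | left t y =>
    obtain ⟨hm, hX'⟩ := hst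
    refine ⟨x, m, hsame _ _ (.left t y) trivial trivial ⟨?_, hX'⟩, Or.inl ⟨rfl, rfl⟩⟩
    have : pos ≠ m := by simpa [St.Marked] using hmk'
    simp only [moveHead]; omega
  | back t y =>
    obtain ⟨hm, hX'⟩ := hst
    have : pos = m := by simpa [St.Marked] using hmk'
    exact ⟨x, m, hsame _ _ (.back t y) trivial trivial ⟨this, hX'⟩, Or.inl ⟨rfl, rfl⟩⟩

end GrammarTM

namespace GrammarTM

variable {T : Type} {G : OmegaPSG T} {u : ℕ → T}

theorem pos_le_of_step {Q Γ : Type*} {δ : Q → Γ → Q → Γ → Move → Prop} {c : ℕ → Cfg Q Γ}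
    (h0 : (c 0).pos = 0) (hs : ∀ i, TMStep δ (c i) (c (i + 1))) (i : ℕ) : (c i).pos ≤ i := by
  induction i with
  | zero => exact h0.le
  | succ i ih =>
    obtain ⟨g, m, -, -, h⟩ := hs i
    rw [h]
    exact (moveHead_le _ _).trans (by omega)

theorem not_bounded_of_complete {Q Γ : Type*} {δ : Q → Γ → Q → Γ → Move → Prop} {c : ℕ → Cfg Q Γ}
    (h0 : (c 0).pos = 0) (hs : ∀ i, TMStep δ (c i) (c (i + 1))) (hcomp : ∀ n, ∃ i, n ≤ (c i).pos)
    (I B : ℕ) : ∃ i, I ≤ i ∧ B < (c i).pos := by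
  obtain ⟨i, hi⟩ := hcomp (B + 1 + I)
  have := pos_le_of_step h0 hs i
  exact ⟨i, by omega, by omega⟩

theorem target_of_ret {c c' : Cfg (St G) (Ga G)} (h : TMStep (Trans G) c c') (hc : c.q = .ret) :
    c'.pos ≤ c.pos ∧ (c'.q = .ret ∨ c'.q = .home) := by
  obtain ⟨g, m, h, -, hp⟩ := h
  rw [hp]
  rw [hc] at h
  generalize c'.q = q' at h ⊢
  generalize c.tape c.pos = g0 at h
  cases h
  · exact ⟨by simp [moveHead], Or.inl rfl⟩
  · exact ⟨le_rfl, Or.inr rfl⟩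

theorem target_of_done {c c' : Cfg (St G) (Ga G)} (h : TMStep (Trans G) c c') {p : G.P}
    (hc : c.q.label = some p) : c'.q = .ret := by
  obtain ⟨g, m, h, -, hp⟩ := h
  generalize c'.q = q' at h ⊢
  generalize c.q = q at h hc
  generalize c.tape c.pos = g0 at h
  cases h <;> simp_all [St.label]

theorem source_ret {c c' : Cfg (St G) (Ga G)} (h : TMStep (Trans G) c c')
    (hc : c'.q = .ret) (hd : c.q.label = none) : c.q = .ret := by
  obtain ⟨g, m, h, -, hp⟩ := h
  rw [hc] at h
  generalize c.q = q at h hd ⊢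
  generalize c.tape c.pos = g0 at h
  cases h
  · simp [St.label] at hd
  · rfl

theorem mem_lang_of_mem_machine_lang [Fintype T] {σ : AccSigma} {ρ : AccRho}
    (hu : u ∈ (machine G ρ).Lang σ ρ) : u ∈ G.Lang σ ρ .nl := by
  obtain ⟨c₀, h0, hs, hcomp, hosc, hacc⟩ := ((machine G ρ).mem_Lang_iff σ ρ u).mp hu
  change ℕ → Cfg {s : St G // s.Valid} (Ga G) at c₀
  obtain ⟨c, hc⟩ : ∃ c : ℕ → Cfg (St G) (Ga G), c = fun i => ⟨(c₀ i).q.1, (c₀ i).tape, (c₀ i).pos⟩ :=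
    ⟨_, rfl⟩
  have hcs : ∀ i, TMStep (Trans G) (c i) (c (i + 1)) := by
    intro i
    rw [hc]
    exact hs i
  have hc0 : c 0 = ⟨.init, fun n => (u n, none, false), 0⟩ := by
    rw [hc]
    simp only [h0]
    rfl
  replace hcomp : ∀ n, ∃ i, n ≤ (c i).pos := by rw [hc]; exact hcomp
  replace hosc : ∀ n, ∃ i0, ∀ i, i0 ≤ i → (c i).pos ≠ n := by rw [hc]; exact hosc
  have hunb := not_bounded_of_complete (by simp [hc0]) hcs hcomp
  obtain ⟨A, hA0, hA⟩ := exists_seq_of_invariant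
    (fun i (a : List (G.N ⊕ T) × ℕ) => Inv u (c i) a.1 a.2)
    (fun i a a' => ((c i).q.label = none ∧ a'.1 = a.1) ∨
      ∃ p, (c i).q.label = some p ∧ G.Step p a.1 a'.1)
    ([.inl G.start], 0) (by
      simp only [hc0]
      exact ⟨fun n => rfl, fun n => by simp [St.Marked], by simp, rfl, fun n => rfl, rfl, rfl⟩)
    (fun i a ha => by
      obtain ⟨x', m', h⟩ := ha.step (hcs i)
      exact ⟨(x', m'), h⟩)
  have hdone : ∀ n, ∃ i, n ≤ i ∧ (c i).q.label ≠ none := by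
    intro n
    by_contra! hcon
    have hconst : ∀ i ≥ n, (A i).1 = (A n).1 := by
      intro i hi
      induction i, hi using Nat.le_induction with
      | base => rfl
      | succ i hi ih =>
        rcases (hA i).2 with ⟨_, h⟩ | ⟨p, h, _⟩
        · rw [h, ih]
        · rw [hcon i hi] at h; simp at h
    have := G.fintypeP
    obtain ⟨B, hB⟩ : ∃ B, ∀ p, (G.rhs p).length ≤ B :=
      ⟨∑ p, (G.rhs p).length, fun p =>
        Finset.single_le_sum (f := fun p => (G.rhs p).length) (fun _ _ => Nat.zero_le _)
          (Finset.mem_univ p)⟩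
    have hbd : ∀ i ≥ n, (c i).pos ≤ (c n).pos + (A n).1.length + B := by
      intro i hi
      induction i, hi using Nat.le_induction with
      | base => omega
      | succ i hi ih =>
        have hinv := (hA (i + 1)).1
        have hx := hconst (i + 1) (by omega)
        have hm : (A (i + 1)).2 ≤ (A n).1.length := by
          by_contra! hlt
          have := hinv.checked _ hlt
          simp [hx] at this
        have hst := hinv.state
        have hlab := hcon (i + 1) (by omega)
        rcases hq : (c (i + 1)).q with _ | _ | _ | _ | p | p | ⟨p, r, w, b⟩ <;> rw [hq] at hst hlab
        · have := hst.1; omega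
        · have := hst.1; omega
        · have := hst.1; omega
        · have := (target_of_ret (hcs i) (source_ret (hcs i) hq (hcon i hi))).1
          omega
        · have := hst.2.1
          rw [hx] at this
          omega
        · simp [St.label] at hlab
        · have h1 := hst.2.2.1
          have h2 := hB p
          rw [hx] at h1
          omega
    obtain ⟨i, hi, hi'⟩ := hunb n ((c n).pos + (A n).1.length + B)
    have := hbd i hi
    omega
  have hhome : ∀ n, ∃ i, n ≤ i ∧ (c i).q = .home := by
    intro n
    by_contra! hcon
    obtain ⟨i, hi, hi'⟩ := hdone n
    obtain ⟨p, hp⟩ := Option.ne_none_iff_exists'.mp hi'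
    have hret : ∀ j ≥ i + 1, (c j).q = .ret ∧ (c j).pos ≤ (c (i + 1)).pos := by
      intro j hj
      induction j, hj using Nat.le_induction with
      | base => exact ⟨target_of_done (hcs i) hp, le_rfl⟩
      | succ j hj ih =>
        obtain ⟨h1, h2⟩ := target_of_ret (hcs j) ih.1
        exact ⟨h2.resolve_right (hcon (j + 1) (by omega)), h1.trans ih.2⟩
    obtain ⟨j, hj, hj'⟩ := hunb (i + 1) (c (i + 1)).pos
    have := (hret j hj).2
    omega
  have hm : ∀ n, ∃ i, n ≤ (A i).2 := by
    intro n
    choose i0 hi0 using hosc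
    obtain ⟨i, hi, hq⟩ := hhome (∑ j ∈ Finset.range n, i0 j)
    refine ⟨i, ?_⟩
    by_contra! hlt
    have hst := (hA i).1.state
    rw [hq] at hst
    have := Finset.single_le_sum (f := i0) (fun _ _ => Nat.zero_le _) (Finset.mem_range.mpr hlt)
    exact hi0 _ i (by omega) hst.1
  obtain ⟨s, d, lev, hst, hAs, hd⟩ := exists_unstutter (fun i => (A i).1) (fun i => (c i).q.label)
    (fun p x y => G.Step p x y) (fun i => (hA i).2) hdone
  refine ⟨s, d, ?_, hd, ?_, ?_, ?_⟩
  · have := hAs 0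
    rw [hA0, hst.zero] at this
    exact this.symm
  · intro n
    obtain ⟨i, hi⟩ := hm n
    refine ⟨lev i, ?_⟩
    rw [← hAs]
    exact hi.trans (le_length_termPrefix fun j hj => ⟨_, (hA i).1.checked j hj⟩)
  · intro k
    rw [matchesPrefix_iff]
    intro j t hj
    obtain ⟨i, hi⟩ := hm (j + 1)
    have hch := (hA i).1.checked j hi
    rw [hAs i] at hch
    have hlen : j < (termPrefix (s (lev i))).length := by
      refine lt_of_lt_of_le hi (le_length_termPrefix fun j hj => ⟨u j, ?_⟩)
      rw [← hAs]
      exact (hA i).1.checked j hj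
    have h1 := List.getElem?_eq_getElem hlen
    have h2 := getElem?_of_termPrefix h1
    rw [hch, Option.some_inj, Sum.inr.injEq] at h2
    obtain ⟨l, hl⟩ := OmegaPSG.termPrefix_grows_of_le hd (le_max_left k (lev i))
    obtain ⟨l', hl'⟩ := OmegaPSG.termPrefix_grows_of_le hd (le_max_right k (lev i))
    obtain ⟨hjl, -⟩ := List.getElem?_eq_some_iff.mp hj
    have h3 : (termPrefix (s (max k (lev i))))[j]? = some t := by
      rw [← hl, List.getElem?_append_left hjl, hj]
    rw [← hl', List.getElem?_append_left hlen, h1, Option.some_inj, ← h2] at h3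
    exact h3.symm
  · have := finite_valid (G := G)
    rw [hc] at hst
    exact (hst.isAccepting_iff (h := fun q : {s : St G // s.Valid} => q.1.label)
      (f := fun i => (c₀ i).q) σ ρ G.acc).mp hacc

end GrammarTM

namespace GrammarTM

/-! #### Completeness -/

variable {T : Type} {G : OmegaPSG T} {u : ℕ → T}

/-- The configuration with work track `X` and marker track `B`. -/
def mkCfg (u : ℕ → T) (q : St G) (X : ℕ → Sy G) (B : ℕ → Bool) (pos : ℕ) : Cfg (St G) (Ga G) :=
  ⟨q, fun n => (u n, X n, B n), pos⟩

/-- The marker track with a mark at `m`. -/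
def mark (m : ℕ) : ℕ → Bool := fun n => decide (n = m)

/-- The work track holding `x`. -/
def content (x : List (G.N ⊕ T)) : ℕ → Sy G := fun n => x[n]?

/-- A step at a position at least `lo`, not completing any production. -/
def Silent (lo : ℕ) (c c' : Cfg (St G) (Ga G)) : Prop :=
  lo ≤ c.pos ∧ c.q.label = none ∧ TMStep (Trans G) c c'

theorem tmStep_mkCfg {q q' : St G} {X : ℕ → Sy G} {B : ℕ → Bool} {pos : ℕ} {y : Sy G} {b : Bool}
    {mv : Move} (h : Trans G q (u pos, X pos, B pos) q' (u pos, y, b) mv) :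
    TMStep (Trans G) (mkCfg u q X B pos)
      (mkCfg u q' (Function.update X pos y) (Function.update B pos b) (moveHead mv pos)) := by
  refine ⟨_, _, h, funext fun n => ?_, rfl⟩
  by_cases hn : n = pos
  · simp [mkCfg, hn]
  · simp [mkCfg, hn]

theorem tmStep_mkCfg_same {q q' : St G} {X : ℕ → Sy G} {B : ℕ → Bool} {pos : ℕ}
    {mv : Move} (h : Trans G q (u pos, X pos, B pos) q' (u pos, X pos, B pos) mv) :
    TMStep (Trans G) (mkCfg u q X B pos) (mkCfg u q' X B (moveHead mv pos)) := by
  simpa using tmStep_mkCfg h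

theorem reach_advance {x : List (G.N ⊕ T)} {m₀ m : ℕ} (hm : m₀ ≤ m)
    (hx : ∀ j < m, x[j]? = some (.inr (u j))) :
    Relation.ReflTransGen (Silent m₀) (mkCfg u .home (content x) (mark m₀) m₀)
      (mkCfg u .home (content x) (mark m) m) := by
  induction m, hm using Nat.le_induction with
  | base => exact .refl
  | succ m hm ih =>
    have hxm : content x m = some (.inr (u m)) := hx m (by omega)
    have h1 : Trans G .home (u m, content x m, mark m m) .adv (u m, content x m, false) .R := by
      rw [hxm]
      simpa [mark] using Trans.out (G := G) (u m)
    have h2 : Trans G .adv (u (m + 1), content x (m + 1), false) .home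
        (u (m + 1), content x (m + 1), true) .S := .adv _ _ _
    have h3 := tmStep_mkCfg h1
    have h4 := tmStep_mkCfg (X := content x) (B := fun _ => false) h2
    have e1 : Function.update (mark m) m false = fun _ => false := by
      ext n
      by_cases hn : n = m <;> simp [mark, hn]
    have e2 : Function.update (fun _ => false) (m + 1) true = mark (m + 1) := by
      ext n
      by_cases hn : n = m + 1 <;> simp [mark, hn]
    rw [e1, Function.update_eq_self] at h3
    rw [e2, Function.update_eq_self] at h4
    exact ((ih fun j hj => hx j (by omega)).tail ⟨hm, rfl, h3⟩).tail
      ⟨hm.trans (Nat.le_succ m), rfl, h4⟩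

theorem reach_home {X : ℕ → Sy G} {m e : ℕ} (hm : m ≤ e) :
    Relation.ReflTransGen (Silent m) (mkCfg u .ret X (mark m) e) (mkCfg u .home X (mark m) m) := by
  induction e, hm using Nat.le_induction with
  | base =>
    refine .single ⟨le_rfl, rfl, tmStep_mkCfg_same (mv := .S) ?_⟩
    simpa [mark] using Trans.back (G := G) (u m) (X m)
  | succ e hm ih =>
    refine .head ⟨by simp only [mkCfg]; omega, rfl, tmStep_mkCfg_same (mv := .L) ?_⟩ ih
    have : mark m (e + 1) = false := by simp [mark]; omega
    rw [this]
    exact .left _ _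

theorem reach_copy {x : List (G.N ⊕ T)} {B : ℕ → Bool} {p : G.P} {m k : ℕ} (hm : m ≤ k)
    (hk : k ≤ x.length) : Relation.ReflTransGen (Silent m) (mkCfg u (.copy p) (content x) B m)
      (mkCfg u (.copy p) (content x) B k) := by
  induction k, hm using Nat.le_induction with
  | base => exact .refl
  | succ k hm ih =>
    refine (ih (by omega)).tail ⟨hm, rfl, tmStep_mkCfg_same (mv := .R) ?_⟩
    rw [show content x k = some x[k] from List.getElem?_eq_getElem hk]
    exact .copy _ _ _ _

theorem reach_done {a v : List (G.N ⊕ T)} {B : ℕ → Bool} {p : G.P} {m : ℕ} (hm : m ≤ a.length) :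
    ∃ e, m ≤ e ∧ Relation.ReflTransGen (Silent m)
      (mkCfg u (.copy p) (content (a ++ (G.lhs p).map .inl ++ v)) B a.length)
      (mkCfg u (.done p) (content (a ++ G.rhs p ++ v)) B e) := by
  set X := content (a ++ (G.lhs p).map .inl ++ v) with hX
  set Y := content (a ++ G.rhs p ++ v) with hY
  set l := (G.lhs p).length with hl
  set b := (G.rhs p).length with hb
  have hXY : ∀ n, n < a.length → X n = Y n := by
    intro n hn
    simp only [hX, hY, content, List.append_assoc, List.getElem?_append_left hn]
  have hXv : ∀ j, X (a.length + j + l) = v[j]? := by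
    intro j
    simp only [hX, content]
    rw [List.getElem?_append_right (by simp; omega)]
    congr 1
    simp; omega
  have hYv : ∀ j, Y (a.length + j + b) = v[j]? := by
    intro j
    simp only [hY, content]
    rw [List.getElem?_append_right (by simp; omega)]
    congr 1
    simp; omega
  have hXn : ∀ n, X n = none ↔ a.length + l + v.length ≤ n := by
    intro n
    simp [hX, content, hl, Nat.add_assoc]
  have hYn : ∀ n, a.length + b + v.length ≤ n → Y n = none := by
    intro n hn
    simp only [hY, content, List.getElem?_eq_none_iff, List.length_append]
    omega
  let Z : ℕ → ℕ → Sy G := fun j n => if n < a.length + j then Y n else X n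
  let K : ℕ → Cfg (St G) (Ga G) := fun j =>
    mkCfg u (.shift p (window X (a.length + j) l) (window Y (a.length + j) b)
      (b - (j - (l + v.length)))) (Z j) B (a.length + j)
  have hZ : ∀ j, Z j (a.length + j) = X (a.length + j) := fun j => if_neg (lt_irrefl _)
  have hK : ∀ j ≤ l + v.length + b, Relation.ReflTransGen (Silent m) (K 0) (K j) := by
    intro j hj
    induction j with
    | zero => exact .refl
    | succ j ih =>
      refine (ih (by omega)).tail ⟨by simp only [K, mkCfg]; omega, rfl, ?_⟩
      have h1 : Trans G (.shift p (window X (a.length + j) l) (window Y (a.length + j) b)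
          (b - (j - (l + v.length)))) (u (a.length + j), Z j (a.length + j), B (a.length + j))
          (.shift p (window X (a.length + (j + 1)) l) (window Y (a.length + (j + 1)) b)
            (b - (j + 1 - (l + v.length))))
          (u (a.length + j), Y (a.length + j), B (a.length + j)) .R := by
        rw [hZ]
        refine .shift _ _ _ _ (v[j]?) ?_ ?_ ?_
        · rw [← hXv, ← window_succ, window_succ', Nat.add_assoc]
        · rw [← hYv, ← window_succ, window_succ', Nat.add_assoc]
        · rw [Ne, hXn]
          omega
      have h2 := tmStep_mkCfg h1
      have e : Function.update (Z j) (a.length + j) (Y (a.length + j)) = Z (j + 1) := by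
        ext1 n
        by_cases hn : n = a.length + j
        · simp [Z, hn]
        · simp only [Z, Function.update_of_ne hn]
          have : n < a.length + j ↔ n < a.length + (j + 1) := by omega
          simp only [this]
      rw [e, Function.update_eq_self] at h2
      exact h2
  have hstart : TMStep (Trans G) (mkCfg u (.copy p) X B a.length) (K 0) := by
    have h1 := tmStep_mkCfg_same (u := u) (Trans.start p (u a.length) (X a.length) (B a.length))
    have e1 : window X a.length l = (G.lhs p).map fun A => some (.inl A) := by
      have := window_getElem?_mid a ((G.lhs p).map .inl) v
      rw [List.length_map, List.map_map] at this
      exact this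
    have e2 : window Y a.length b = (G.rhs p).map some := window_getElem?_mid a (G.rhs p) v
    have e3 : Z 0 = X := by
      ext1 n
      by_cases hn : n < a.length
      · simp [Z, hn, hXY n hn]
      · simp [Z, hn]
    simp only [K, Nat.add_zero, e1, e2, e3, Nat.zero_sub, Nat.sub_zero]
    exact h1
  refine ⟨a.length + (l + v.length + b), by omega,
    .head ⟨hm, rfl, hstart⟩ ((hK _ le_rfl).tail ⟨?_, rfl, ?_⟩)⟩
  · simp only [K, mkCfg]; omega
  · have e : Z (l + v.length + b) = Y := by
      ext1 n
      by_cases hn : n < a.length + (l + v.length + b)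
      · simp [Z, hn]
      · simp only [Z, if_neg hn]
        rw [hYn n (by omega), hXn]
        omega
    simp only [K, e]
    refine tmStep_mkCfg_same (mv := .S) ?_
    rw [hYn _ (by omega)]
    refine .finish _ _ ?_ ?_ <;>
    · intro o ho
      obtain ⟨i, -, rfl⟩ := List.mem_map.mp ho
      first
        | exact (hXn _).mpr (by omega)
        | exact hYn _ (by omega)

theorem reach_rewrite {x y : List (G.N ⊕ T)} {p : G.P} (h : G.Step p x y) {m₀ m : ℕ} (hm : m₀ ≤ m)
    (hx : ∀ j < m, x[j]? = some (.inr (u j))) :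
    ∃ e, m ≤ e ∧ Relation.ReflTransGen (Silent m₀) (mkCfg u .home (content x) (mark m₀) m₀)
      (mkCfg u (.done p) (content y) (mark m) e) := by
  obtain ⟨a, v, rfl, rfl⟩ := h
  have hma : m ≤ a.length := by
    by_contra! hlt
    have h1 := hx _ hlt
    obtain ⟨A, l, hl⟩ := List.exists_cons_of_ne_nil (G.lhs_ne p)
    simp [hl] at h1
  obtain ⟨e, he, h⟩ := reach_done (u := u) (p := p) (v := v) (B := mark m) hma
  have hmono : ∀ c c', Silent (G := G) m c c' → Silent m₀ c c' :=
    fun c c' h => ⟨hm.trans h.1, h.2⟩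
  have hcopy := reach_copy (u := u) (x := a ++ (G.lhs p).map .inl ++ v) (B := mark m) (p := p) hma
    (by simp only [List.length_append]; omega)
  refine ⟨e, he, (reach_advance hm hx).trans (.head (b := mkCfg u (.copy p) _ (mark m) m)
    ⟨hm, rfl, tmStep_mkCfg_same (mv := .S) ?_⟩ (.trans
      (Relation.ReflTransGen.mono hmono _ _ hcopy) (Relation.ReflTransGen.mono hmono _ _ h)))⟩
  simpa [mark] using Trans.pick (G := G) p (u m) _

theorem mem_machine_lang_of_mem_lang [Fintype T] {σ : AccSigma} {ρ : AccRho}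
    (hu : u ∈ G.Lang σ ρ .nl) : u ∈ (machine G ρ).Lang σ ρ := by
  obtain ⟨s, d, h0, hs, hgrow, hmatch, hacc⟩ := hu
  set len : ℕ → ℕ := fun k => (termPrefix (s k)).length with hlen
  have hs : ∀ k, G.Step (d k) (s k) (s (k + 1)) := hs
  have hx : ∀ k, ∀ j < len k, (s k)[j]? = some (.inr (u j)) := by
    intro k j hj
    have h1 := List.getElem?_eq_getElem hj
    rw [getElem?_of_termPrefix h1, matchesPrefix_iff.mp (hmatch k) _ _ h1]
  have hmono : ∀ {k k'}, k ≤ k' → len k ≤ len k' := fun h =>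
    (OmegaPSG.termPrefix_grows_of_le hs h).length_le
  let lo : ℕ → ℕ := fun k => match k with
    | 0 => 0
    | k + 1 => len k
  have hlo : ∀ k, lo k ≤ len k := by
    rintro (_ | k)
    · exact Nat.zero_le _
    · exact hmono (Nat.le_succ k)
  choose e he hreach using fun k => reach_rewrite (u := u) (hs k) (hlo k) (hx k)
  let C : ℕ → Cfg (St G) (Ga G) := fun k => match k with
    | 0 => ⟨.init, fun n => (u n, none, false), 0⟩
    | k + 1 => mkCfg u .ret (content (s (k + 1))) (mark (len k)) (e k)
  let C' : ℕ → Cfg (St G) (Ga G) := fun k =>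
    mkCfg u (.done (d k)) (content (s (k + 1))) (mark (len k)) (e k)
  have hsilent : ∀ k, Relation.ReflTransGen (Silent (lo k)) (C k) (C' k) := by
    rintro (_ | k)
    · refine .head ⟨le_rfl, rfl, ?_⟩ (hreach 0)
      have h1 := tmStep_mkCfg (u := u) (X := fun _ => none) (B := fun _ => false) (pos := 0)
        (Trans.init (G := G) (u 0) none false)
      have e1 : Function.update (fun _ => none) 0 (some (.inl G.start)) = content (G := G) (s 0) := by
        ext1 n
        rcases n with _ | n <;> simp [content, h0]
      have e2 : Function.update (fun _ => false) 0 true = mark 0 := by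
        ext n
        by_cases hn : n = 0 <;> simp [mark, hn]
      rw [e1, e2] at h1
      exact h1
    · exact (reach_home (he k)).trans (hreach (k + 1))
  obtain ⟨f, lev, hf0, hlev0, hunb, hf⟩ := exists_concat (fun k => Silent (lo k))
    (fun k c c' => lo k ≤ c.pos ∧ c.q.label = some (d k) ∧ TMStep (Trans G) c c') C C' hsilent
    (fun k => ⟨(hlo k).trans (he k), rfl, tmStep_mkCfg_same (.done _ _)⟩)
  have hstep : ∀ i, TMStep (Trans G) (f i) (f (i + 1)) := by
    intro i
    rcases hf i with h | h
    · exact h.1.2.2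
    · exact h.1.2.2
  have hpos : ∀ i, lo (lev i) ≤ (f i).pos := by
    intro i
    rcases hf i with h | h
    · exact h.1.1
    · exact h.1.1
  have hst : Stutter (fun i => (f i).q.label) d lev := by
    refine ⟨hlev0, hunb, fun i => ?_⟩
    rcases hf i with h | h
    · exact Or.inl ⟨h.1.2.1, h.2⟩
    · exact Or.inr ⟨h.1.2.1, h.2⟩
  have hvalid : ∀ i, (f i).q.Valid := by
    intro i
    induction i with
    | zero => rw [hf0]; trivial
    | succ i ih =>
      obtain ⟨_, _, h, -⟩ := hstep i
      exact h.valid ih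
  have hge : ∀ n, ∃ i0, ∀ i, i0 ≤ i → n ≤ (f i).pos := by
    intro n
    obtain ⟨k, hk⟩ := hgrow n
    obtain ⟨i0, hi0⟩ := hunb (k + 1)
    refine ⟨i0, fun i hi => le_trans ?_ (hpos i)⟩
    obtain ⟨k', hk'⟩ : ∃ k', lev i = k' + 1 :=
      Nat.exists_eq_add_one.mpr (by have := hst.mono hi; omega)
    rw [hk']
    exact hk.trans (hmono (by have := hst.mono hi; omega))
  rw [OmegaTM.mem_Lang_iff]
  refine ⟨fun i => ⟨⟨(f i).q, hvalid i⟩, (f i).tape, (f i).pos⟩, ?_, hstep, ?_, ?_, ?_⟩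
  · simp only [hf0]
    rfl
  · intro n
    obtain ⟨i0, h⟩ := hge n
    exact ⟨i0, h i0 le_rfl⟩
  · intro n
    obtain ⟨i0, h⟩ := hge (n + 1)
    exact ⟨i0, fun i hi => Nat.ne_of_gt (h i hi)⟩
  · have := finite_valid (G := G)
    exact (hst.isAccepting_iff (h := fun q : {s : St G // s.Valid} => q.1.label)
      (f := fun i => ⟨(f i).q, hvalid i⟩) σ ρ G.acc).mpr hacc

theorem machine_lang [Fintype T] (G : OmegaPSG T) (σ : AccSigma) (ρ : AccRho) :
    (machine G ρ).Lang σ ρ = G.Lang σ ρ .nl :=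
  Set.ext fun _ => ⟨mem_lang_of_mem_machine_lang, mem_machine_lang_of_mem_lang⟩

end GrammarTM
end OmegaFormal

open OmegaFormal

/-- Theorem: 𝓛_{σ,ρ,nl}(ω-PSG) = 𝓛_{σ,ρ}(ω-TM) for every acceptance mode (σ,ρ). -/
theorem psg_nl_eq_tm (T : Type) [Fintype T] (σ : AccSigma) (ρ : AccRho) :
    GLang T (fun _ => True) σ ρ DerivMode.nl = TMLang T σ ρ := by
  ext L
  constructor
  · rintro ⟨G, -, rfl⟩
    exact ⟨GrammarTM.machine G ρ, (GrammarTM.machine_lang G σ ρ).symm⟩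
  · rintro ⟨M, rfl⟩
    exact ⟨TMGrammar.grammar M ρ, trivial, (TMGrammar.grammar_lang M σ ρ).symm⟩
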